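/- Uniqueness of the viscosity solution: the system of variational inequalities with inter-connected obstacles min{v_i(t,x) − max_{j≠i}(−g_ij(t,x)+v_j(t,x)), −∂_t v_i(t,x) − A v_i(t,x) − ψ_i(t,x)} = 0 (i ∈ I), v_i(T,·) ≡ 0, has at most one viscosity solution in the class C: if (v_1,…,v_m) and (v̄_1,…,v̄_m) are both viscosity solutions belonging to C, then v_i = v̄_i on [0,T]×ℝ^k for every i ∈ I. -/

import Mathlib

open Set

noncomputable section

namespace SwitchingPDE

/-- Maximum of `f` over the indices `j ≠ i` (the inter-connected obstacle). -/
def maxNe {m : ℕ} (i : Fin m) (f : Fin m → ℝ) : ℝ :=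
  ⨆ j : {j : Fin m // j ≠ i}, f (j : Fin m)

variable {k d m : ℕ}

/-- The second order operator
`Aφ(t,x) = (1/2) Tr[σ(t,x)σ(t,x)* D²_{xx}φ(t,x)] + ⟨b(t,x), D_xφ(t,x)⟩`. -/
def opA (σ : ℝ → EuclideanSpace ℝ (Fin k) → Fin k → Fin d → ℝ)
    (b : ℝ → EuclideanSpace ℝ (Fin k) → EuclideanSpace ℝ (Fin k))
    (φ : ℝ × EuclideanSpace ℝ (Fin k) → ℝ) (t : ℝ) (x : EuclideanSpace ℝ (Fin k)) : ℝ :=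
  (1 / 2) * ∑ p : Fin k, ∑ q : Fin k, (∑ r : Fin d, σ t x p r * σ t x q r) *
      (fderiv ℝ (fun z : ℝ × EuclideanSpace ℝ (Fin k) =>
        fderiv ℝ φ z (0, EuclideanSpace.single q 1)) (t, x)) (0, EuclideanSpace.single p 1)
    + fderiv ℝ φ (t, x) (0, b t x)

/-- Time derivative `∂_t φ(t,x)` of a function of `(t,x)`. -/
def dt (φ : ℝ × EuclideanSpace ℝ (Fin k) → ℝ) (t : ℝ) (x : EuclideanSpace ℝ (Fin k)) : ℝ :=
  fderiv ℝ φ (t, x) (1, 0)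

/-- Viscosity supersolution of the system of variational inequalities with inter-connected
obstacles `min{v_i − max_{j≠i}(−g_{ij}+v_j), −∂_t v_i − A v_i − ψ_i} = 0`: whenever a smooth
test function `φ` touches `v_i` at `(t₀,x₀)` with a local maximum of `φ − v_i` on
`[0,T] × ℝ^k`, the corresponding expression is `≥ 0`. -/
def IsViscositySupersolution (T : ℝ)
    (σ : ℝ → EuclideanSpace ℝ (Fin k) → Fin k → Fin d → ℝ)
    (b : ℝ → EuclideanSpace ℝ (Fin k) → EuclideanSpace ℝ (Fin k))
    (ψ : Fin m → ℝ → EuclideanSpace ℝ (Fin k) → ℝ)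
    (g : Fin m → Fin m → ℝ → EuclideanSpace ℝ (Fin k) → ℝ)
    (v : Fin m → ℝ → EuclideanSpace ℝ (Fin k) → ℝ) : Prop :=
  ∀ i : Fin m, ∀ t₀ ∈ Ico (0 : ℝ) T, ∀ x₀ : EuclideanSpace ℝ (Fin k),
    ∀ φ : ℝ × EuclideanSpace ℝ (Fin k) → ℝ, ContDiff ℝ 2 φ →
      φ (t₀, x₀) = v i t₀ x₀ →
      IsLocalMaxOn (fun p : ℝ × EuclideanSpace ℝ (Fin k) => φ p - v i p.1 p.2)
        (Icc 0 T ×ˢ univ) (t₀, x₀) →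
      0 ≤ min (v i t₀ x₀ - maxNe i fun j => -(g i j t₀ x₀) + v j t₀ x₀)
          (-(dt φ t₀ x₀) - opA σ b φ t₀ x₀ - ψ i t₀ x₀)

/-- Viscosity subsolution: whenever a smooth test function `φ` touches `v_i` at `(t₀,x₀)`
with a local minimum of `φ − v_i` on `[0,T] × ℝ^k`, the corresponding expression is `≤ 0`. -/
def IsViscositySubsolution (T : ℝ)
    (σ : ℝ → EuclideanSpace ℝ (Fin k) → Fin k → Fin d → ℝ)
    (b : ℝ → EuclideanSpace ℝ (Fin k) → EuclideanSpace ℝ (Fin k))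
    (ψ : Fin m → ℝ → EuclideanSpace ℝ (Fin k) → ℝ)
    (g : Fin m → Fin m → ℝ → EuclideanSpace ℝ (Fin k) → ℝ)
    (v : Fin m → ℝ → EuclideanSpace ℝ (Fin k) → ℝ) : Prop :=
  ∀ i : Fin m, ∀ t₀ ∈ Ico (0 : ℝ) T, ∀ x₀ : EuclideanSpace ℝ (Fin k),
    ∀ φ : ℝ × EuclideanSpace ℝ (Fin k) → ℝ, ContDiff ℝ 2 φ →
      φ (t₀, x₀) = v i t₀ x₀ →
      IsLocalMinOn (fun p : ℝ × EuclideanSpace ℝ (Fin k) => φ p - v i p.1 p.2)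
        (Icc 0 T ×ˢ univ) (t₀, x₀) →
      min (v i t₀ x₀ - maxNe i fun j => -(g i j t₀ x₀) + v j t₀ x₀)
          (-(dt φ t₀ x₀) - opA σ b φ t₀ x₀ - ψ i t₀ x₀) ≤ 0

/-- Membership in the class `C` of continuous functions on `[0,T] × ℝ^k` of polynomial
growth. -/
def InClassC (T : ℝ) (v : ℝ → EuclideanSpace ℝ (Fin k) → ℝ) : Prop :=
  ContinuousOn (fun p : ℝ × EuclideanSpace ℝ (Fin k) => v p.1 p.2) (Icc 0 T ×ˢ univ) ∧
    ∃ C γ : ℝ, ∀ t ∈ Icc (0 : ℝ) T, ∀ x, |v t x| ≤ C * (1 + ‖x‖ ^ γ)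

/-- The standing hypotheses on the coefficients `b, σ` and the data `ψ, g` of the system of
variational inequalities with inter-connected obstacles. -/
structure PDEHyps (T α : ℝ)
    (σ : ℝ → EuclideanSpace ℝ (Fin k) → Fin k → Fin d → ℝ)
    (b : ℝ → EuclideanSpace ℝ (Fin k) → EuclideanSpace ℝ (Fin k))
    (ψ : Fin m → ℝ → EuclideanSpace ℝ (Fin k) → ℝ)
    (g : Fin m → Fin m → ℝ → EuclideanSpace ℝ (Fin k) → ℝ) : Prop where
  σ_cont : ∀ p r, ContinuousOn
    (fun q : ℝ × EuclideanSpace ℝ (Fin k) => σ q.1 q.2 p r) (Icc 0 T ×ˢ univ)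
  b_cont : ContinuousOn
    (fun q : ℝ × EuclideanSpace ℝ (Fin k) => b q.1 q.2) (Icc 0 T ×ˢ univ)
  lipschitz : ∃ C : ℝ, ∀ t ∈ Icc (0 : ℝ) T, ∀ x x' : EuclideanSpace ℝ (Fin k),
    (∑ p : Fin k, ∑ r : Fin d, |σ t x p r - σ t x' p r|) + ‖b t x - b t x'‖ ≤ C * ‖x - x'‖
  ψ_cont : ∀ i, ContinuousOn
    (fun p : ℝ × EuclideanSpace ℝ (Fin k) => ψ i p.1 p.2) (Icc 0 T ×ˢ univ)
  g_cont : ∀ i j, ContinuousOn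
    (fun p : ℝ × EuclideanSpace ℝ (Fin k) => g i j p.1 p.2) (Icc 0 T ×ˢ univ)
  poly_growth : ∃ C γ : ℝ, ∀ i j, ∀ t ∈ Icc (0 : ℝ) T, ∀ x,
    |ψ i t x| + |g i j t x| ≤ C * (1 + ‖x‖ ^ γ)
  g_diag : ∀ i, ∀ t ∈ Icc (0 : ℝ) T, ∀ x, g i i t x = 0
  g_nonneg : ∀ i j, ∀ t ∈ Icc (0 : ℝ) T, ∀ x, 0 ≤ g i j t x
  g_triangle : ∀ i j l, j ≠ i → l ≠ i → l ≠ j → ∀ t ∈ Icc (0 : ℝ) T, ∀ x,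
    g i l t x < g i j t x + g j l t x
  g_alpha : ∀ i j, i ≠ j → ∀ t ∈ Icc (0 : ℝ) T, ∀ x, α < g i j t x + g j i t x

end SwitchingPDE

end

section
open Set Filter Topology

theorem oneD (D : ℝ → ℝ) (ε K : ℝ)
    (h : ∀ s ∈ Icc (0:ℝ) 1, ∀ t ∈ Icc (0:ℝ) 1, D t - D s ≤ ε * |t - s| + K * (t - s) ^ 2) :
    |D 1 - D 0| ≤ ε := by
  have key : ∀ n : ℕ, 0 < n → |D 1 - D 0| ≤ ε + K * (1 / (n:ℝ)) := by
    intro n hn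
    have hn' : (0:ℝ) < n := by exact_mod_cast hn
    have ind : ∀ j : ℕ, j ≤ n → |D (j / n) - D 0| ≤ j * (ε / n + K / n ^ 2) := by
      intro j
      induction j with
      | zero => intro _; simp
      | succ j ih =>
        intro hj
        have ih' := ih (by omega)
        have hj' : ((j:ℝ) + 1) ≤ n := by exact_mod_cast hj
        have m1 : ((j:ℝ) / n) ∈ Icc (0:ℝ) 1 :=
          ⟨by positivity, by rw [div_le_one hn']; linarith⟩
        have m2 : (((j:ℝ)+1) / n) ∈ Icc (0:ℝ) 1 :=
          ⟨by positivity, by rw [div_le_one hn']; linarith⟩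
        have a := h _ m1 _ m2
        have b := h _ m2 _ m1
        have e1 : ((j:ℝ)+1) / n - j / n = 1 / n := by field_simp; ring
        have e2 : (j:ℝ) / n - (j+1) / n = -(1 / n) := by field_simp; ring
        have e3 : |(1:ℝ) / n| = 1 / n := abs_of_pos (by positivity)
        rw [e1, e3] at a
        rw [e2, abs_neg, e3] at b
        have e4 : ε * (1 / n) + K * (1 / (n:ℝ)) ^ 2 = ε / n + K / n ^ 2 := by field_simp
        have e5 : ε * (1 / n) + K * (-(1 / (n:ℝ))) ^ 2 = ε / n + K / n ^ 2 := by field_simp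
        rw [e4] at a
        rw [e5] at b
        push_cast
        rw [abs_le] at ih' ⊢
        constructor <;> nlinarith [ih'.1, ih'.2]
    have := ind n le_rfl
    rw [div_self hn'.ne'] at this
    refine this.trans (le_of_eq ?_)
    field_simp
  have lim : Tendsto (fun n : ℕ => ε + K * (1 / (n:ℝ))) atTop (𝓝 (ε + K * 0)) :=
    tendsto_const_nhds.add (tendsto_const_nhds.mul tendsto_one_div_atTop_nhds_zero_nat)
  rw [mul_zero, add_zero] at lim
  refine ge_of_tendsto lim ?_
  filter_upwards [eventually_gt_atTop 0] with n hn using key n hn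

section
variable {E : Type*} [NormedAddCommGroup E] [InnerProductSpace ℝ E]

theorem contact_grad_eq (w : E → ℝ) (c : ℝ) (hc : 0 < c) (z p g : E)
    (hg : ∀ z', w z + inner ℝ g (z' - z) - c / 2 * ‖z' - z‖ ^ 2 ≤ w z')
    (hp : ∀ᶠ e in 𝓝 (0:E), w (z + e) ≤ w z + inner ℝ p e) : g = p := by
  by_contra hne
  set v := g - p with hv
  have hv0 : 0 < ‖v‖ := norm_pos_iff.mpr (sub_ne_zero.mpr hne)
  have lim : Tendsto (fun s : ℝ => s • v) (𝓝[>] 0) (𝓝 0) := by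
    have : Tendsto (fun s : ℝ => s • v) (𝓝 0) (𝓝 ((0:ℝ) • v)) :=
      (continuous_id.smul continuous_const).tendsto 0
    rw [zero_smul] at this
    exact this.mono_left nhdsWithin_le_nhds
  have h1 := lim.eventually hp
  have h2 : ∀ᶠ s : ℝ in 𝓝[>] 0, s < 1 / c := by
    have : ∀ᶠ s : ℝ in 𝓝 0, s < 1 / c := eventually_lt_nhds (by positivity)
    exact this.filter_mono nhdsWithin_le_nhds
  have h3 : ∀ᶠ s : ℝ in 𝓝[>] 0, (0:ℝ) < s := eventually_mem_nhdsWithin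
  obtain ⟨s, ⟨a, b⟩, hs⟩ := ((h1.and h2).and h3).exists
  have h4 := hg (z + s • v)
  rw [add_sub_cancel_left] at h4
  have e1 : inner ℝ g (s • v) - inner ℝ p (s • v) = s * ‖v‖ ^ 2 := by
    rw [← inner_sub_left, ← hv, inner_smul_right, real_inner_self_eq_norm_sq]
  rw [norm_smul, mul_pow, Real.norm_eq_abs, sq_abs] at h4
  have h5 : s * ‖v‖ ^ 2 ≤ c / 2 * (s ^ 2 * ‖v‖ ^ 2) := by linarith
  rw [lt_div_iff₀ hc] at b
  have h6 : c / 2 * (s ^ 2 * ‖v‖ ^ 2) = (s * c / 2) * (s * ‖v‖ ^ 2) := by ring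
  have h7 : 0 < s * ‖v‖ ^ 2 := by positivity
  nlinarith

theorem contact_lip (w : E → ℝ) (c : ℝ) (hc : 0 < c) (g : E → E)
    (hg : ∀ z z', w z + inner ℝ (g z) (z' - z) - c / 2 * ‖z' - z‖ ^ 2 ≤ w z') (z p : E)
    (hp : ∀ᶠ e in 𝓝 (0:E), w (z + e) ≤ w z + inner ℝ p e) :
    ∀ᶠ d in 𝓝 (0:E), ‖g (z + d) - p‖ ≤ c * ‖d‖ := by
  have hgz : g z = p := contact_grad_eq w c hc z p (g z) (hg z) hp
  obtain ⟨R, hR, hball⟩ := Metric.eventually_nhds_iff.mp hp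
  rw [Metric.eventually_nhds_iff]
  refine ⟨R / 2, by positivity, fun d hd => ?_⟩
  rw [dist_zero_right] at hd
  set v := g (z + d) - p with hv
  by_cases hv0 : v = 0
  · rw [hv0, norm_zero]; positivity
  by_cases hd0 : d = 0
  · exfalso; apply hv0; rw [hv, hd0, add_zero, hgz, sub_self]
  have hvp : 0 < ‖v‖ := norm_pos_iff.mpr hv0
  have hdp : 0 < ‖d‖ := norm_pos_iff.mpr hd0
  set e := (‖d‖ / ‖v‖) • v with he
  have hen : ‖e‖ = ‖d‖ := by
    rw [he, norm_smul, Real.norm_eq_abs, abs_of_pos (by positivity)]; field_simp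
  have hve : inner ℝ v e = ‖d‖ * ‖v‖ := by
    rw [he, inner_smul_right, real_inner_self_eq_norm_sq]; field_simp
  have h1 := hg (z + d) (z + d + e)
  rw [add_sub_cancel_left, hen] at h1
  have h2 := hg z (z + d)
  rw [add_sub_cancel_left, hgz] at h2
  have h3 := @hball (d + e) (by
    rw [dist_zero_right]
    calc ‖d + e‖ ≤ ‖d‖ + ‖e‖ := norm_add_le _ _
      _ < R := by rw [hen]; linarith)
  rw [← add_assoc, inner_add_right] at h3
  have h4 : inner ℝ v e = inner ℝ (g (z + d)) e - inner ℝ p e := by rw [hv, inner_sub_left]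
  have h5 : ‖d‖ * ‖v‖ ≤ c * ‖d‖ ^ 2 := by rw [← hve, h4]; linarith
  have h6 : ‖d‖ * ‖v‖ ≤ ‖d‖ * (c * ‖d‖) := by linarith
  exact le_of_mul_le_mul_left h6 hdp

/-- second order expansion from first order expansion of the subgradient selection -/
theorem second_order (w : E → ℝ) (c : ℝ) (hc : 0 < c) (g : E → E)
    (hg : ∀ z z', w z + inner ℝ (g z) (z' - z) - c / 2 * ‖z' - z‖ ^ 2 ≤ w z') (z p : E)
    (S : E →L[ℝ] E)
    (hS : ∀ μ > 0, ∀ᶠ d in 𝓝 (0:E), ‖g (z + d) - p - S d‖ ≤ μ * ‖d‖) (μ : ℝ) (hμ : 0 < μ) :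
    ∀ᶠ e in 𝓝 (0:E), |w (z + e) - w z - inner ℝ p e - 1 / 2 * inner ℝ (S e) e| ≤ μ * ‖e‖ ^ 2 := by
  obtain ⟨R, hR, hball⟩ := Metric.eventually_nhds_iff.mp (hS μ hμ)
  rw [Metric.eventually_nhds_iff]
  refine ⟨R, hR, fun e he => ?_⟩
  rw [dist_zero_right] at he
  set D : ℝ → ℝ := fun t => w (z + t • e) - t * inner ℝ p e - t ^ 2 / 2 * inner ℝ (S e) e with hD
  have := oneD D (μ * ‖e‖ ^ 2) (c / 2 * ‖e‖ ^ 2 + |inner ℝ (S e) e| / 2) ?_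
  · have e0 : D 1 - D 0 = w (z + e) - w z - inner ℝ p e - 1 / 2 * inner ℝ (S e) e := by
      simp [hD]; ring
    rwa [e0] at this
  intro s hs t ht
  have h1 := hg (z + t • e) (z + s • e)
  have e1 : z + s • e - (z + t • e) = (s - t) • e := by rw [sub_smul]; abel
  rw [e1, norm_smul, mul_pow, Real.norm_eq_abs, sq_abs, inner_smul_right] at h1
  have hte : ‖t • e‖ ≤ ‖e‖ := by
    rw [norm_smul, Real.norm_eq_abs, abs_of_nonneg ht.1]
    nlinarith [ht.2, norm_nonneg e]
  have h2 := @hball (t • e) (by rw [dist_zero_right]; linarith)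
  have h3 : |inner ℝ (g (z + t • e) - p - S (t • e)) e| ≤ μ * ‖e‖ ^ 2 := by
    calc _ ≤ ‖g (z + t • e) - p - S (t • e)‖ * ‖e‖ := abs_real_inner_le_norm _ _
      _ ≤ (μ * ‖e‖) * ‖e‖ := by
          gcongr
          exact h2.trans (by gcongr)
      _ = _ := by ring
  rw [inner_sub_left, inner_sub_left, map_smul, inner_smul_left] at h3
  simp only [conj_trivial] at h3
  set G := inner ℝ (g (z + t • e)) e
  set a := inner ℝ p e
  set b := inner ℝ (S e) e
  have h4 : (t - s) * (G - a - t * b) ≤ μ * ‖e‖ ^ 2 * |t - s| := by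
    calc _ ≤ |(t - s) * (G - a - t * b)| := le_abs_self _
      _ = |t - s| * |G - a - t * b| := abs_mul _ _
      _ ≤ |t - s| * (μ * ‖e‖ ^ 2) := by gcongr
      _ = _ := by ring
  have h5 : b * (t - s) ^ 2 ≤ |b| * (t - s) ^ 2 := by gcongr; exact le_abs_self b
  simp only [hD]
  nlinarith

end
end

section
open Set Filter Topology

section
variable {E : Type*} [NormedAddCommGroup E] [InnerProductSpace ℝ E] [FiniteDimensional ℝ E]

/-- Lipschitz images of a.e. good points: small vectors hit at differentiability points. -/
theorem exists_good_value (P Q : E → E) (C C' : NNReal) (hP : LipschitzWith C P)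
    (hQ : LipschitzWith C' Q) (ρ : ℝ) (hρ : 0 < ρ) :
    ∃ p : E, ‖p‖ < ρ ∧ ∀ y, Q y = p → DifferentiableAt ℝ P y := by
  let _ : MeasurableSpace E := borel E
  have _ : BorelSpace E := ⟨rfl⟩
  let μ : MeasureTheory.Measure E := MeasureTheory.Measure.hausdorffMeasure (Module.finrank ℝ E)
  have hae : ∀ᵐ y ∂μ, DifferentiableAt ℝ P y := hP.ae_differentiableAt
  have hN : μ {y | ¬ DifferentiableAt ℝ P y} = 0 := hae
  have hQN : μ (Q '' {y | ¬ DifferentiableAt ℝ P y}) = 0 := by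
    have := (hQ.lipschitzOnWith (s := {y | ¬ DifferentiableAt ℝ P y})).hausdorffMeasure_image_le
      (d := (Module.finrank ℝ E : ℝ)) (Nat.cast_nonneg _)
    refine le_antisymm (this.trans ?_) (zero_le)
    change _ * μ _ ≤ 0
    rw [hN, mul_zero]
  have hball : 0 < μ (Metric.ball (0:E) ρ) := Metric.measure_ball_pos μ 0 hρ
  have hnot : ¬ (Metric.ball (0:E) ρ ⊆ Q '' {y | ¬ DifferentiableAt ℝ P y}) := by
    intro hsub
    have := MeasureTheory.measure_mono (μ := μ) hsub
    rw [hQN] at this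
    exact absurd hball (not_lt.mpr this)
  obtain ⟨p, hp, hpn⟩ := not_subset.mp hnot
  refine ⟨p, by simpa using hp, fun y hy => ?_⟩
  by_contra hnd
  exact hpn ⟨y, hnd, hy⟩

/-- inversion of a first order expansion -/
theorem inverse_expansion (P : E → E) (Y : E → E) (hPY : ∀ z, P (Y z) = z) (z : E)
    (hd : DifferentiableAt ℝ P (Y z)) (K : ℝ)
    (hK : ∀ᶠ d in 𝓝 (0:E), ‖Y (z + d) - Y z‖ ≤ K * ‖d‖) :
    ∃ S : E →L[ℝ] E, ∀ μ > 0, ∀ᶠ d in 𝓝 (0:E), ‖Y (z + d) - Y z - S d‖ ≤ μ * ‖d‖ := by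
  set B := fderiv ℝ P (Y z) with hB
  have hK0 : ∀ᶠ d in 𝓝 (0:E), ‖Y (z + d) - Y z‖ ≤ (|K| + 1) * ‖d‖ := by
    filter_upwards [hK] with d h
    refine h.trans ?_
    gcongr
    linarith [le_abs_self K]
  set K' := |K| + 1 with hK'
  have hK'p : 0 < K' := by positivity
  have lim : Tendsto (fun d : E => Y (z + d) - Y z) (𝓝 0) (𝓝 0) := by
    have : Tendsto (fun d : E => K' * ‖d‖) (𝓝 0) (𝓝 0) := by
      have h : Tendsto (fun d : E => K' * ‖d‖) (𝓝 0) (𝓝 (K' * ‖(0:E)‖)) :=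
        (continuous_const.mul continuous_norm).tendsto 0
      simpa using h
    exact squeeze_zero_norm' hK0 this
  have hexp : ∀ μ > 0, ∀ᶠ d in 𝓝 (0:E), ‖d - B (Y (z + d) - Y z)‖ ≤ μ * ‖d‖ := by
    intro μ hμ
    have h1 := (hasFDerivAt_iff_isLittleO_nhds_zero.mp hd.hasFDerivAt).def
      (show 0 < μ / K' by positivity)
    have h2 := lim.eventually h1
    filter_upwards [h2, hK0] with d a b
    rw [add_sub_cancel, hPY, hPY, add_sub_cancel_left] at a
    refine a.trans ?_
    calc μ / K' * ‖Y (z + d) - Y z‖ ≤ μ / K' * (K' * ‖d‖) := by gcongr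
      _ = μ * ‖d‖ := by field_simp
  have hsurj : Function.Surjective B := by
    have hcl : IsClosed ((LinearMap.range (B : E →ₗ[ℝ] E) : Submodule ℝ E) : Set E) :=
      Submodule.closed_of_finiteDimensional _
    intro e
    have hmem : e ∈ closure ((LinearMap.range (B : E →ₗ[ℝ] E) : Submodule ℝ E) : Set E) := by
      rw [Metric.mem_closure_iff]
      intro ε hε
      have h1 := hexp (ε / (2 * (‖e‖ + 1))) (by positivity)
      have lim2 : Tendsto (fun s : ℝ => s • e) (𝓝[>] 0) (𝓝 0) := by
        have : Tendsto (fun s : ℝ => s • e) (𝓝 0) (𝓝 ((0:ℝ) • e)) :=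
          (continuous_id.smul continuous_const).tendsto 0
        rw [zero_smul] at this
        exact this.mono_left nhdsWithin_le_nhds
      obtain ⟨s, a, hs⟩ := ((lim2.eventually h1).and
        (eventually_mem_nhdsWithin : ∀ᶠ s : ℝ in 𝓝[>] 0, s ∈ Ioi (0:ℝ))).exists
      have hs : 0 < s := hs
      refine ⟨B (s⁻¹ • (Y (z + s • e) - Y z)), ⟨_, rfl⟩, ?_⟩
      rw [dist_eq_norm, map_smul]
      have e1 : e - s⁻¹ • B (Y (z + s • e) - Y z) = s⁻¹ • (s • e - B (Y (z + s • e) - Y z)) := by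
        rw [smul_sub, smul_smul, inv_mul_cancel₀ hs.ne', one_smul]
      rw [e1, norm_smul, Real.norm_eq_abs, abs_of_pos (by positivity)]
      rw [norm_smul, Real.norm_eq_abs, abs_of_pos hs] at a
      calc s⁻¹ * ‖s • e - B (Y (z + s • e) - Y z)‖
          ≤ s⁻¹ * (ε / (2 * (‖e‖ + 1)) * (s * ‖e‖)) := by gcongr
        _ = ε / 2 * (‖e‖ / (‖e‖ + 1)) := by field_simp
        _ ≤ ε / 2 * 1 := by
            gcongr
            rw [div_le_one (by positivity)]; linarith
        _ < ε := by linarith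
    rw [hcl.closure_eq] at hmem
    exact hmem
  have hinj : Function.Injective B :=
    (LinearMap.injective_iff_surjective (f := (B : E →ₗ[ℝ] E))).mpr hsurj
  let Be : E ≃L[ℝ] E := (LinearEquiv.ofBijective (B : E →ₗ[ℝ] E) ⟨hinj, hsurj⟩).toContinuousLinearEquiv
  have hBe : ∀ x, Be x = B x := fun x => rfl
  refine ⟨(Be.symm : E →L[ℝ] E), fun μ hμ => ?_⟩
  set N := ‖(Be.symm : E →L[ℝ] E)‖ + 1 with hN
  have hNp : 0 < N := by positivity
  filter_upwards [hexp (μ / N) (by positivity)] with d h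
  have e1 : Y (z + d) - Y z - Be.symm d = -((Be.symm : E →L[ℝ] E) (d - B (Y (z + d) - Y z))) := by
    rw [map_sub, ← hBe]
    simp
  change ‖Y (z + d) - Y z - Be.symm d‖ ≤ _
  rw [e1, norm_neg]
  calc _ ≤ ‖(Be.symm : E →L[ℝ] E)‖ * ‖d - B (Y (z + d) - Y z)‖ := ContinuousLinearMap.le_opNorm _ _
    _ ≤ N * (μ / N * ‖d‖) := by gcongr; linarith
    _ = μ * ‖d‖ := by field_simp

theorem jensen_alexandrov (w : E → ℝ) (c : ℝ) (hc : 0 < c) (hcont : Continuous w)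
    (hw : ∀ z, ∃ g : E, ∀ z', w z + inner ℝ g (z' - z) - c / 2 * ‖z' - z‖ ^ 2 ≤ w z')
    (r η : ℝ) (hr : 0 < r) (hη : 0 < η)
    (hmax : ∀ z, ‖z‖ ≤ r → w z ≤ w 0 - η / 2 * ‖z‖ ^ 2) (ρ : ℝ) (hρ : 0 < ρ) :
    ∃ z p : E, ∃ S : E →L[ℝ] E, ‖z‖ < ρ ∧ ‖p‖ < ρ ∧
      (∀ᶠ e in 𝓝 (0:E), w (z + e) ≤ w z + inner ℝ p e) ∧
      ∀ μ > 0, ∀ᶠ e in 𝓝 (0:E),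
        |w (z + e) - w z - inner ℝ p e - 1 / 2 * inner ℝ (S e) e| ≤ μ * ‖e‖ ^ 2 := by
  choose g hg using hw
  set Y : E → E := fun z => (1 + c) • z + g z with hY
  have hexpand : ∀ z z', ‖z' - z‖ ≤ ‖Y z' - Y z‖ := by
    intro z z'
    have h1 := hg z z'
    have h2 := hg z' z
    have e1 : z - z' = -(z' - z) := by abel
    rw [e1, inner_neg_right, norm_neg] at h2
    have e2 : inner ℝ (Y z' - Y z) (z' - z) =
        (1 + c) * ‖z' - z‖ ^ 2 + (inner ℝ (g z') (z' - z) - inner ℝ (g z) (z' - z)) := by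
      have : Y z' - Y z = (1 + c) • (z' - z) + (g z' - g z) := by
        simp only [hY, smul_sub]; abel
      rw [this, inner_add_left, inner_smul_left, real_inner_self_eq_norm_sq, inner_sub_left]
      simp
    have h3 : ‖z' - z‖ ^ 2 ≤ ‖Y z' - Y z‖ * ‖z' - z‖ := by
      refine le_trans ?_ (real_inner_le_norm _ _)
      rw [e2]; linarith
    by_cases h0 : ‖z' - z‖ = 0
    · rw [h0]; positivity
    · have : 0 < ‖z' - z‖ := lt_of_le_of_ne (norm_nonneg _) (Ne.symm h0)
      rw [pow_two] at h3
      exact le_of_mul_le_mul_right h3 this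
  have hinj : Function.Injective Y := by
    intro a b hab
    have := hexpand b a
    rw [hab, sub_self, norm_zero] at this
    exact sub_eq_zero.mp (norm_le_zero_iff.mp this)
  have hlipOn : LipschitzOnWith 1 (Function.invFun Y) (range Y) := by
    apply LipschitzOnWith.of_dist_le_mul
    rintro _ ⟨a, rfl⟩ _ ⟨b, rfl⟩
    rw [Function.leftInverse_invFun hinj a, Function.leftInverse_invFun hinj b, dist_eq_norm,
      dist_eq_norm]
    simpa using hexpand b a
  obtain ⟨P, hPlip, hPeq⟩ := hlipOn.extend_finite_dimension
  have hPY : ∀ z, P (Y z) = z := fun z => by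
    rw [← hPeq (mem_range_self z), Function.leftInverse_invFun hinj z]
  have hQlip := ((LipschitzWith.id (α := E)).sub ((lipschitzWith_smul (1 + c)).comp hPlip))
  set ρ' := min ρ (min (η * ρ / 4) (η * r / 4)) with hρ'
  have hρ'p : 0 < ρ' := by positivity
  obtain ⟨p, hpn, hpd⟩ := exists_good_value P _ _ _ hPlip hQlip ρ' hρ'p
  obtain ⟨z, hzB, hzmax⟩ := (isCompact_closedBall (0:E) r).exists_isMaxOn
    ⟨0, Metric.mem_closedBall_self hr.le⟩
    (f := fun z => w z - inner ℝ p z) (by fun_prop)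
  have hz1 := hzmax (Metric.mem_closedBall_self hr.le)
  simp only [mem_ofPred_eq, inner_zero_right, sub_zero] at hz1
  rw [mem_closedBall_zero_iff] at hzB
  have hz2 := hmax z hzB
  have hz3 : η / 2 * ‖z‖ ^ 2 ≤ ‖p‖ * ‖z‖ := by
    have := neg_le_of_abs_le (abs_real_inner_le_norm p z)
    linarith
  have hz4 : η / 2 * ‖z‖ ≤ ‖p‖ := by
    by_cases h0 : ‖z‖ = 0
    · rw [h0]; simp
    · have : 0 < ‖z‖ := lt_of_le_of_ne (norm_nonneg _) (Ne.symm h0)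
      exact le_of_mul_le_mul_right (by nlinarith) this
  have hp1 : ‖p‖ < ρ := hpn.trans_le (min_le_left _ _)
  have hp2 : ‖p‖ < η * ρ / 4 := hpn.trans_le ((min_le_right _ _).trans (min_le_left _ _))
  have hp3 : ‖p‖ < η * r / 4 := hpn.trans_le ((min_le_right _ _).trans (min_le_right _ _))
  have hzρ : ‖z‖ < ρ := by nlinarith
  have hzr : ‖z‖ < r := by nlinarith
  have hcontact : ∀ᶠ e in 𝓝 (0:E), w (z + e) ≤ w z + inner ℝ p e := by
    have h1 : ∀ᶠ e in 𝓝 (0:E), ‖z + e‖ < r := by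
      have : Tendsto (fun e : E => ‖z + e‖) (𝓝 0) (𝓝 ‖z + 0‖) :=
        (by fun_prop : Continuous fun e : E => ‖z + e‖).tendsto 0
      rw [add_zero] at this
      exact this.eventually (eventually_lt_nhds hzr)
    filter_upwards [h1] with e he
    have := hzmax (mem_closedBall_zero_iff.mpr he.le)
    simp only [mem_ofPred_eq, inner_add_right] at this
    linarith
  have hgz : g z = p := contact_grad_eq w c hc z p (g z) (hg z) hcontact
  have hlip := contact_lip w c hc g hg z p hcontact
  have hdiff : DifferentiableAt ℝ P (Y z) := by
    apply hpd
    simp only [id, Function.comp, hPY]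
    simp only [hY, hgz]
    abel
  have hYd : ∀ d, Y (z + d) - Y z = (1 + c) • d + (g (z + d) - p) := by
    intro d
    simp only [hY, hgz, smul_add]; abel
  obtain ⟨S, hS⟩ := inverse_expansion P Y hPY z hdiff (1 + c + c) (by
    filter_upwards [hlip] with d hd
    rw [hYd]
    calc _ ≤ ‖(1 + c) • d‖ + ‖g (z + d) - p‖ := norm_add_le _ _
      _ ≤ (1 + c) * ‖d‖ + c * ‖d‖ := by
        rw [norm_smul, Real.norm_eq_abs, abs_of_pos (by positivity)]; gcongr
      _ = _ := by ring)
  refine ⟨z, p, S - (1 + c) • ContinuousLinearMap.id ℝ E, hzρ, hp1, hcontact, fun μ hμ => ?_⟩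
  refine second_order w c hc g hg z p _ (fun ν hν => ?_) μ hμ
  filter_upwards [hS ν hν] with d hd
  rw [hYd] at hd
  convert hd using 2
  simp
  abel
end
end

section
open Set Filter Topology

noncomputable section
section
variable {F : Type*} [NormedAddCommGroup F] [InnerProductSpace ℝ F]

/-- the real inner product as a continuous bilinear map -/
def innerB (F : Type*) [NormedAddCommGroup F] [InnerProductSpace ℝ F] : F →L[ℝ] F →L[ℝ] ℝ :=
  (isBoundedBilinearMap_inner (𝕜 := ℝ) (E := F)).toContinuousLinearMap

@[simp] theorem innerB_apply (x y : F) : innerB F x y = inner ℝ x y := rfl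

theorem quad_add (Bq : F →L[ℝ] F →L[ℝ] ℝ) (hs : ∀ x y, Bq x y = Bq y x) (x y : F) :
    Bq (x + y) (x + y) = Bq x x + 2 * Bq x y + Bq y y := by
  simp only [map_add, ContinuousLinearMap.add_apply]
  rw [hs y x]; ring

theorem quad_le (Bq : F →L[ℝ] F →L[ℝ] ℝ) (x : F) : Bq x x ≤ (‖Bq‖ + 1) * ‖x‖ ^ 2 := by
  have h := Bq.le_opNorm₂ x x
  have h2 := (le_abs_self (Bq x x)).trans ((Real.norm_eq_abs _).symm.le.trans h)
  nlinarith [sq_nonneg ‖x‖]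

theorem quad_add_le (Bq : F →L[ℝ] F →L[ℝ] ℝ) (hs : ∀ x y, Bq x y = Bq y x)
    (hn : ∀ x, 0 ≤ Bq x x) (x y : F) :
    Bq (x + y) (x + y) ≤ 2 * Bq x x + 2 * Bq y y := by
  have h1 := quad_add Bq hs x y
  have h2 := quad_add Bq hs x (-y)
  have h3 := hn (x + -y)
  simp only [map_neg, ContinuousLinearMap.neg_apply] at h2
  simp only [h2] at h3
  linarith

theorem norm_sub_sq_le (x y : F) : ‖x - y‖ ^ 2 ≤ 2 * (‖x‖ ^ 2 + ‖y‖ ^ 2) := by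
  nlinarith [norm_sub_le x y, norm_nonneg (x - y), norm_nonneg x, norm_nonneg y,
    sq_nonneg (‖x‖ - ‖y‖)]

/-- sup-convolution over a compact set -/
theorem supconv (K : Set F) (hK : IsCompact K) (hne : K.Nonempty) (U : F → ℝ)
    (hU : ContinuousOn U K) (κ : ℝ) :
    ∃ W : F → ℝ, Continuous W ∧ (∀ h, ∀ h' ∈ K, U h' - κ / 2 * ‖h - h'‖ ^ 2 ≤ W h) ∧
      ∀ h, ∃ h' ∈ K, W h = U h' - κ / 2 * ‖h - h'‖ ^ 2 := by
  have hcs : CompactSpace K := isCompact_iff_compactSpace.mp hK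
  have hUr : Continuous (fun x : K => U x) := continuousOn_iff_continuous_domRestrict.mp hU
  let f : F → K → ℝ := fun h x => U x - κ / 2 * ‖h - x‖ ^ 2
  have hf : Continuous (Function.uncurry f) := by
    have : Function.uncurry f = fun q : F × K => U q.2 - κ / 2 * ‖q.1 - (q.2 : F)‖ ^ 2 := by
      ext q; rfl
    rw [this]
    have h1 : Continuous (fun q : F × K => U q.2) := hUr.comp continuous_snd
    exact h1.sub (continuous_const.mul
      ((continuous_fst.sub (continuous_subtype_val.comp continuous_snd)).norm.pow 2))
  have hfh : ∀ h, Continuous (f h) := fun h => hf.comp (Continuous.prodMk_right h)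
  have hcomp : ∀ h, IsCompact (f h '' univ) := fun h => isCompact_univ.image (hfh h)
  have hKne : Nonempty K := hne.to_subtype
  refine ⟨fun h => sSup (f h '' univ), isCompact_univ.continuous_sSup hf, ?_, ?_⟩
  · intro h h' hh'
    exact le_csSup (hcomp h).bddAbove ⟨⟨h', hh'⟩, mem_univ _, rfl⟩
  · intro h
    obtain ⟨x, _, hx⟩ := (hcomp h).sSup_mem (univ_nonempty.image _)
    exact ⟨x, x.2, hx.symm⟩

theorem supconv_sub (K : Set F) (U W : F → ℝ) (κ : ℝ)
    (h1 : ∀ h, ∀ h' ∈ K, U h' - κ / 2 * ‖h - h'‖ ^ 2 ≤ W h)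
    (h2 : ∀ h, ∃ h' ∈ K, W h = U h' - κ / 2 * ‖h - h'‖ ^ 2) (z : F) :
    ∃ g : F, ∀ z', W z + inner ℝ g (z' - z) - κ / 2 * ‖z' - z‖ ^ 2 ≤ W z' := by
  obtain ⟨h', hK, e⟩ := h2 z
  refine ⟨(-κ) • (z - h'), fun z' => ?_⟩
  have := h1 z' h' hK
  have e2 : z' - h' = (z - h') + (z' - z) := by abel
  rw [e2, norm_add_sq_real] at this
  rw [e, inner_smul_left]
  simp only [conj_trivial]
  linarith

theorem supconv_transfer (K : Set F) (U W : F → ℝ) (κ : ℝ)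
    (h1 : ∀ h, ∀ h' ∈ K, U h' - κ / 2 * ‖h - h'‖ ^ 2 ≤ W h) (a a0 : F)
    (ha : K ∈ 𝓝 a) (e : W a0 = U a - κ / 2 * ‖a0 - a‖ ^ 2) :
    ∀ᶠ e in 𝓝 (0:F), U (a + e) - U a ≤ W (a0 + e) - W a0 := by
  have : Tendsto (fun e : F => a + e) (𝓝 0) (𝓝 a) := by
    have h : Tendsto (fun e : F => a + e) (𝓝 0) (𝓝 (a + 0)) :=
      (continuous_const.add continuous_id).tendsto 0
    rwa [add_zero] at h
  filter_upwards [this ha] with d hd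
  have h3 := h1 (a0 + d) (a + d) hd
  rw [add_sub_add_right_eq_sub] at h3
  linarith

variable [FiniteDimensional ℝ F]

theorem JA_prod (W1 W2 : F → ℝ) (c1 : Continuous W1) (c2 : Continuous W2) (κ : ℝ) (hκ : 0 < κ)
    (s1 : ∀ z, ∃ g : F, ∀ z', W1 z + inner ℝ g (z' - z) - κ / 2 * ‖z' - z‖ ^ 2 ≤ W1 z')
    (s2 : ∀ z, ∃ g : F, ∀ z', W2 z + inner ℝ g (z' - z) - κ / 2 * ‖z' - z‖ ^ 2 ≤ W2 z')
    (Bq : F →L[ℝ] F →L[ℝ] ℝ) (hs : ∀ x y, Bq x y = Bq y x)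
    (η : ℝ) (hη : 0 < η) (hle : ∀ h k, W1 h + W2 k ≤ Bq (h - k) (h - k))
    (z1 : W1 0 = 0) (z2 : W2 0 = 0) (ρ : ℝ) (hρ : 0 < ρ) :
    ∃ a b p1 p2 : F, ∃ B1 B2 : F →L[ℝ] F →L[ℝ] ℝ, ‖a‖ < ρ ∧ ‖b‖ < ρ ∧ ‖p1‖ < ρ ∧ ‖p2‖ < ρ ∧
      (∀ μ > 0, ∀ᶠ e in 𝓝 (0:F), W1 (a + e) ≤ W1 a + inner ℝ p1 e + 2 * Bq (a - b) e
        + η * inner ℝ a e + 1 / 2 * B1 e e + Bq e e + η / 2 * ‖e‖ ^ 2 + μ * ‖e‖ ^ 2) ∧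
      (∀ μ > 0, ∀ᶠ e in 𝓝 (0:F), W2 (b + e) ≤ W2 b + inner ℝ p2 e - 2 * Bq (a - b) e
        + η * inner ℝ b e + 1 / 2 * B2 e e + Bq e e + η / 2 * ‖e‖ ^ 2 + μ * ‖e‖ ^ 2) ∧
      ∀ h k, B1 h h + B2 k k + 4 * Bq h k ≤ 0 := by
  let Z := WithLp 2 (F × F)
  let f1 : Z →L[ℝ] F := WithLp.fstL 2 ℝ F F
  let f2 : Z →L[ℝ] F := WithLp.sndL 2 ℝ F F
  let J : F × F →L[ℝ] Z := ((WithLp.prodContinuousLinearEquiv 2 ℝ F F).symm : F × F →L[ℝ] Z)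
  let i1 : F →L[ℝ] Z := J.comp (ContinuousLinearMap.inl ℝ F F)
  let i2 : F →L[ℝ] Z := J.comp (ContinuousLinearMap.inr ℝ F F)
  have f1i1 : ∀ e, f1 (i1 e) = e := fun e => rfl
  have f2i1 : ∀ e, f2 (i1 e) = 0 := fun e => rfl
  have f1i2 : ∀ e, f1 (i2 e) = 0 := fun e => rfl
  have f2i2 : ∀ e, f2 (i2 e) = e := fun e => rfl
  have hin : ∀ x y : Z, inner ℝ x y = inner ℝ (f1 x) (f1 y) + inner ℝ (f2 x) (f2 y) :=
    fun x y => rfl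
  have hnorm : ∀ x : Z, ‖x‖ ^ 2 = ‖f1 x‖ ^ 2 + ‖f2 x‖ ^ 2 := fun x =>
    WithLp.prod_norm_sq_eq_of_L2 x
  let w : Z → ℝ := fun x => W1 (f1 x) + W2 (f2 x) - Bq (f1 x - f2 x) (f1 x - f2 x)
    - η / 2 * ‖x‖ ^ 2
  have hwdef : ∀ x, w x = W1 (f1 x) + W2 (f2 x) - Bq (f1 x - f2 x) (f1 x - f2 x)
    - η / 2 * ‖x‖ ^ 2 := fun x => rfl
  have hwc : Continuous w := by
    have a1 : Continuous (fun x : Z => W1 (f1 x)) := c1.comp f1.continuous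
    have a2 : Continuous (fun x : Z => W2 (f2 x)) := c2.comp f2.continuous
    have a3 : Continuous (fun x : Z => Bq (f1 x - f2 x) (f1 x - f2 x)) := by fun_prop
    exact ((a1.add a2).sub a3).sub (by fun_prop)
  set Q := ‖Bq‖ + 1 with hQ
  have hQp : 0 < Q := by positivity
  have key := jensen_alexandrov w (κ + 4 * Q + η) (by positivity) hwc ?_ 1 η one_pos hη ?_ ρ hρ
  · obtain ⟨z, p, S, hz, hp, hcon, hexp⟩ := key
    have hfn : ∀ x : Z, ‖f1 x‖ ≤ ‖x‖ ∧ ‖f2 x‖ ≤ ‖x‖ := by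
      intro x
      have := hnorm x
      constructor <;> refine le_of_sq_le_sq ?_ (norm_nonneg _) <;>
        nlinarith [sq_nonneg ‖f1 x‖, sq_nonneg ‖f2 x‖]
    have w1 : ∀ e, w (z + i1 e) - w z = W1 (f1 z + e) - W1 (f1 z) - 2 * Bq (f1 z - f2 z) e
        - Bq e e - η * inner ℝ (f1 z) e - η / 2 * ‖e‖ ^ 2 := by
      intro e
      simp only [hwdef, hnorm, map_add f1, map_add f2, f1i1, f2i1, add_zero]
      have : f1 z + e - f2 z = (f1 z - f2 z) + e := by abel
      rw [this, quad_add Bq hs, norm_add_sq_real]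
      ring
    have w2 : ∀ e, w (z + i2 e) - w z = W2 (f2 z + e) - W2 (f2 z) + 2 * Bq (f1 z - f2 z) e
        - Bq e e - η * inner ℝ (f2 z) e - η / 2 * ‖e‖ ^ 2 := by
      intro e
      simp only [hwdef, hnorm, map_add f1, map_add f2, f1i2, f2i2, add_zero]
      rw [← sub_sub, sub_eq_add_neg (f1 z - f2 z) e, quad_add Bq hs, norm_add_sq_real]
      simp only [map_neg, ContinuousLinearMap.neg_apply]
      ring
    have w12 : ∀ h k, w (z + (i1 h + i2 k)) - w z =
        (w (z + i1 h) - w z) + (w (z + i2 k) - w z) + 2 * Bq h k := by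
      intro h k
      rw [w1, w2]
      simp only [hwdef, hnorm, map_add f1, map_add f2, f1i1, f2i1, f1i2, f2i2, add_zero, zero_add]
      have : f1 z + h - (f2 z + k) = (f1 z - f2 z) + (h + -k) := by abel
      rw [this, quad_add Bq hs, quad_add Bq hs h, norm_add_sq_real, norm_add_sq_real]
      simp only [map_neg, map_add, ContinuousLinearMap.neg_apply]
      ring
    have t1 : Tendsto i1 (𝓝 0) (𝓝 0) := by
      have := i1.continuous.tendsto 0
      rwa [map_zero] at this
    have t2 : Tendsto i2 (𝓝 0) (𝓝 0) := by
      have := i2.continuous.tendsto 0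
      rwa [map_zero] at this
    have n1 : ∀ e, ‖i1 e‖ ^ 2 = ‖e‖ ^ 2 := fun e => by rw [hnorm, f1i1, f2i1]; simp
    have n2 : ∀ e, ‖i2 e‖ ^ 2 = ‖e‖ ^ 2 := fun e => by rw [hnorm, f1i2, f2i2]; simp
    have ip1 : ∀ e, inner ℝ p (i1 e) = inner ℝ (f1 p) e := fun e => by
      rw [hin, f1i1, f2i1]; simp
    have ip2 : ∀ e, inner ℝ p (i2 e) = inner ℝ (f2 p) e := fun e => by
      rw [hin, f1i2, f2i2]; simp
    refine ⟨f1 z, f2 z, f1 p, f2 p, (innerB Z).bilinearComp (S.comp i1) i1,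
      (innerB Z).bilinearComp (S.comp i2) i2, (hfn z).1.trans_lt hz, (hfn z).2.trans_lt hz,
      (hfn p).1.trans_lt hp, (hfn p).2.trans_lt hp, ?_, ?_, ?_⟩
    · intro μ hμ
      filter_upwards [t1.eventually (hexp μ hμ)] with e he
      have := (abs_le.mp he).2
      rw [n1, ip1, w1] at this
      simp only [ContinuousLinearMap.bilinearComp_apply, innerB_apply,
        ContinuousLinearMap.comp_apply] at this ⊢
      linarith
    · intro μ hμ
      filter_upwards [t2.eventually (hexp μ hμ)] with e he
      have := (abs_le.mp he).2
      rw [n2, ip2, w2] at this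
      simp only [ContinuousLinearMap.bilinearComp_apply, innerB_apply,
        ContinuousLinearMap.comp_apply] at this ⊢
      linarith
    · intro h k
      simp only [ContinuousLinearMap.bilinearComp_apply, innerB_apply,
        ContinuousLinearMap.comp_apply]
      set A := inner ℝ (S (i1 h)) (i1 h) + inner ℝ (S (i2 k)) (i2 k) + 4 * Bq h k with hA
      have hAμ : ∀ μ > 0, A ≤ μ * (2 * (‖h‖ ^ 2 + ‖k‖ ^ 2)) := by
        intro μ hμ
        have lim : ∀ x : Z, Tendsto (fun s : ℝ => s • x) (𝓝[>] 0) (𝓝 0) := by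
          intro x
          have : Tendsto (fun s : ℝ => s • x) (𝓝 0) (𝓝 ((0:ℝ) • x)) :=
            (continuous_id.smul continuous_const).tendsto 0
          rw [zero_smul] at this
          exact this.mono_left nhdsWithin_le_nhds
        obtain ⟨s, ⟨⟨q1, q2⟩, q3⟩, hs0⟩ := ((((lim (i1 h)).eventually (hexp μ hμ)).and
          ((lim (i2 k)).eventually (hexp μ hμ))).and
          ((lim (i1 h + i2 k)).eventually hcon)).and
          (eventually_mem_nhdsWithin : ∀ᶠ s : ℝ in 𝓝[>] 0, s ∈ Ioi (0:ℝ)) |>.exists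
        have hs0 : 0 < s := hs0
        have q1 := (abs_le.mp q1).1
        have q2 := (abs_le.mp q2).1
        have q4 := w12 (s • h) (s • k)
        rw [map_smul i1, map_smul i2, ← smul_add] at q4
        simp only [map_smul, norm_smul, mul_pow, inner_smul_left, inner_smul_right, n1, n2,
          conj_trivial, Real.norm_eq_abs, sq_abs, inner_add_right, ContinuousLinearMap.smul_apply,
          smul_eq_mul] at q1 q2 q3 q4
        have q5 : s ^ 2 * A ≤ s ^ 2 * (μ * (2 * (‖h‖ ^ 2 + ‖k‖ ^ 2))) := by
          rw [hA]; linarith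
        exact le_of_mul_le_mul_left q5 (by positivity)
      by_contra hcontra
      have hApos : 0 < A := not_le.mp hcontra
      have := hAμ (A / (2 * (2 * (‖h‖ ^ 2 + ‖k‖ ^ 2) + 1))) (by positivity)
      have h2 : A / (2 * (2 * (‖h‖ ^ 2 + ‖k‖ ^ 2) + 1)) * (2 * (‖h‖ ^ 2 + ‖k‖ ^ 2)) < A := by
        rw [div_mul_eq_mul_div, div_lt_iff₀ (by positivity)]
        nlinarith [sq_nonneg ‖h‖, sq_nonneg ‖k‖]
      linarith
  · intro z
    obtain ⟨g1, h1⟩ := s1 (f1 z)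
    obtain ⟨g2, h2⟩ := s2 (f2 z)
    let ℓ : Z →L[ℝ] ℝ := (innerB F g1).comp f1 + (innerB F g2).comp f2
      - (2:ℝ) • (Bq (f1 z - f2 z)).comp (f1 - f2) - η • innerB Z z
    refine ⟨(InnerProductSpace.toDual ℝ Z).symm ℓ, fun z' => ?_⟩
    rw [InnerProductSpace.toDual_symm_apply]
    obtain ⟨e, rfl⟩ : ∃ e, z' = z + e := ⟨z' - z, by abel⟩
    rw [add_sub_cancel_left]
    have a1 := h1 (f1 (z + e))
    have a2 := h2 (f2 (z + e))
    rw [map_add, add_sub_cancel_left] at a1 a2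
    have e1 : ℓ e = inner ℝ g1 (f1 e) + inner ℝ g2 (f2 e) - 2 * Bq (f1 z - f2 z) (f1 e - f2 e)
      - η * inner ℝ z e := rfl
    rw [e1]
    simp only [hwdef, map_add]
    have e2 : f1 z + f1 e - (f2 z + f2 e) = (f1 z - f2 z) + (f1 e - f2 e) := by abel
    have e3 := quad_add Bq hs (f1 z - f2 z) (f1 e - f2 e)
    have e4 := (quad_le Bq (f1 e - f2 e)).trans
      (mul_le_mul_of_nonneg_left (norm_sub_sq_le (f1 e) (f2 e)) hQp.le)
    rw [← hnorm] at e4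
    rw [e2, e3, norm_add_sq_real]
    have e5 := hnorm e
    have e6 : κ / 2 * ‖e‖ ^ 2 = κ / 2 * ‖f1 e‖ ^ 2 + κ / 2 * ‖f2 e‖ ^ 2 := by rw [e5]; ring
    linarith
  · intro z _
    have h0 : w 0 = 0 := by simp [hwdef, z1, z2]
    rw [h0]
    have := hle (f1 z) (f2 z)
    simp only [hwdef]
    linarith
end
end
end

section
open Set Filter Topology

noncomputable section
section
variable {F : Type*} [NormedAddCommGroup F] [InnerProductSpace ℝ F]

theorem argmax_bound (U W : F → ℝ) (K : Set F) (Q : ℝ) (hQ : 0 < Q)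
    (h1 : ∀ h, ∀ h' ∈ K, U h' - 4 * Q / 2 * ‖h - h'‖ ^ 2 ≤ W h) (h0 : (0:F) ∈ K)
    (hU0 : U 0 = 0) (hUle : ∀ h ∈ K, U h ≤ Q / 2 * ‖h‖ ^ 2) (a a0 : F) (haK : a ∈ K)
    (e : W a0 = U a - 4 * Q / 2 * ‖a0 - a‖ ^ 2) : ‖a‖ ≤ 4 * ‖a0‖ := by
  have q1 := h1 a0 0 h0
  rw [hU0, sub_zero, e] at q1
  have q2 := hUle a haK
  have q3 : Q * ‖a0 - a‖ ^ 2 ≤ Q * (1 / 4 * ‖a‖ ^ 2 + ‖a0‖ ^ 2) := by nlinarith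
  have q4 := le_of_mul_le_mul_left q3 hQ
  have q5 : ‖a0 - a‖ ≤ 1 / 2 * ‖a‖ + ‖a0‖ := by
    refine le_of_sq_le_sq ?_ (by positivity)
    nlinarith [norm_nonneg a, norm_nonneg a0, mul_nonneg (norm_nonneg a) (norm_nonneg a0)]
  have q6 : ‖a‖ ≤ ‖a0‖ + ‖a0 - a‖ := by
    have : a = a0 - (a0 - a) := by abel
    calc ‖a‖ = ‖a0 - (a0 - a)‖ := by rw [← this]
      _ ≤ _ := norm_sub_le _ _
  linarith

variable [FiniteDimensional ℝ F]

theorem sums_core (U V : F → ℝ) (r : ℝ) (hr : 0 < r)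
    (cU : ContinuousOn U (Metric.closedBall 0 r)) (cV : ContinuousOn V (Metric.closedBall 0 r))
    (U0 : U 0 = 0) (V0 : V 0 = 0)
    (Bq : F →L[ℝ] F →L[ℝ] ℝ) (hs : ∀ x y, Bq x y = Bq y x) (hn : ∀ x, 0 ≤ Bq x x)
    (hle : ∀ h ∈ Metric.closedBall (0:F) r, ∀ k ∈ Metric.closedBall (0:F) r,
      U h + V k ≤ 1 / 2 * Bq (h - k) (h - k)) (η : ℝ) (hη : 0 < η) :
    ∃ a b : F, ∃ l1 l2 : F →L[ℝ] ℝ, ∃ S1 S2 : F →L[ℝ] F →L[ℝ] ℝ,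
      ‖a‖ < η ∧ ‖b‖ < η ∧ (∀ e, |l1 e| ≤ η * ‖e‖) ∧ (∀ e, |l2 e| ≤ η * ‖e‖) ∧
      (∀ᶠ e in 𝓝 (0:F), U (a + e) ≤ U a + l1 e + 1 / 2 * S1 e e) ∧
      (∀ᶠ e in 𝓝 (0:F), V (b + e) ≤ V b + l2 e + 1 / 2 * S2 e e) ∧
      ∀ h k, S1 h h + S2 k k ≤ 2 * Bq (h - k) (h - k) + η * (‖h‖ ^ 2 + ‖k‖ ^ 2) := by
  set K := Metric.closedBall (0:F) r with hK
  have h0K : (0:F) ∈ K := Metric.mem_closedBall_self hr.le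
  have hKc : IsCompact K := isCompact_closedBall _ _
  set Q := ‖Bq‖ + 1 with hQ
  have hQp : 0 < Q := by positivity
  obtain ⟨W1, c1, g1, e1⟩ := supconv K hKc ⟨0, h0K⟩ U cU (4 * Q)
  obtain ⟨W2, c2, g2, e2⟩ := supconv K hKc ⟨0, h0K⟩ V cV (4 * Q)
  have hW : ∀ h k, W1 h + W2 k ≤ Bq (h - k) (h - k) := by
    intro h k
    obtain ⟨h', hh', q1⟩ := e1 h
    obtain ⟨k', hk', q2⟩ := e2 k
    have q3 := hle h' hh' k' hk'
    have q4 : h' - k' = (h - k) + ((k - k') - (h - h')) := by abel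
    have q5 := quad_add_le Bq hs hn (h - k) ((k - k') - (h - h'))
    rw [← q4] at q5
    have q6 := (quad_le Bq ((k - k') - (h - h'))).trans
      (mul_le_mul_of_nonneg_left (norm_sub_sq_le _ _) hQp.le)
    rw [q1, q2]
    linarith
  have w1n := g1 0 0 h0K
  have w2n := g2 0 0 h0K
  have w12 := hW 0 0
  simp only [sub_zero, norm_zero, U0, V0, map_zero] at w1n w2n w12
  have z1 : W1 0 = 0 := by linarith
  have z2 : W2 0 = 0 := by linarith
  set ρ := min η r / (4 * (2 + 4 * Q + η / 2)) with hρ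
  have hmin : 0 < min η r := lt_min hη hr
  have hρp : 0 < ρ := by positivity
  have hρe : 4 * (2 + 4 * Q + η / 2) * ρ = min η r := by
    rw [hρ]; field_simp
  have hρη : 4 * ρ < η := by
    have := min_le_left η r
    nlinarith
  have hρr : 4 * ρ < r := by
    have := min_le_right η r
    nlinarith
  have hρl : (1 + 4 * Q + η / 2) * ρ ≤ η := by
    have := min_le_left η r
    nlinarith
  obtain ⟨a0, b0, p1, p2, B1, B2, na, nb, np1, np2, x1, x2, hB⟩ :=
    JA_prod W1 W2 c1 c2 (4 * Q) (by positivity) (supconv_sub K U W1 _ g1 e1)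
      (supconv_sub K V W2 _ g2 e2) Bq hs (η / 2) (by positivity) hW z1 z2 ρ hρp
  obtain ⟨a, haK, ea⟩ := e1 a0
  obtain ⟨b, hbK, eb⟩ := e2 b0
  have hUle : ∀ h ∈ K, U h ≤ Q / 2 * ‖h‖ ^ 2 := by
    intro h hh
    have := hle h hh 0 h0K
    rw [V0, sub_zero] at this
    have := quad_le Bq h
    linarith
  have hVle : ∀ h ∈ K, V h ≤ Q / 2 * ‖h‖ ^ 2 := by
    intro h hh
    have := hle 0 h0K h hh
    rw [U0, zero_sub] at this
    have h2 := quad_le Bq (-h)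
    rw [norm_neg] at h2
    linarith
  have hna := argmax_bound U W1 K Q hQp g1 h0K U0 hUle a a0 haK ea
  have hnb := argmax_bound V W2 K Q hQp g2 h0K V0 hVle b b0 hbK eb
  have hKa : K ∈ 𝓝 a := Metric.closedBall_mem_nhds_of_mem
    (by rw [Metric.mem_ball, dist_zero_right]; linarith)
  have hKb : K ∈ 𝓝 b := Metric.closedBall_mem_nhds_of_mem
    (by rw [Metric.mem_ball, dist_zero_right]; linarith)
  have t1 := supconv_transfer K U W1 _ g1 a a0 hKa ea
  have t2 := supconv_transfer K V W2 _ g2 b b0 hKb eb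
  have hBe : ∀ e, |Bq (a0 - b0) e| ≤ 2 * Q * ρ * ‖e‖ := by
    intro e
    have q1 := Bq.le_opNorm₂ (a0 - b0) e
    rw [Real.norm_eq_abs] at q1
    refine q1.trans (mul_le_mul_of_nonneg_right ?_ (norm_nonneg e))
    have q2 : ‖a0 - b0‖ ≤ 2 * ρ := (norm_sub_le _ _).trans (by linarith)
    calc ‖Bq‖ * ‖a0 - b0‖ ≤ Q * (2 * ρ) :=
          mul_le_mul (by linarith) q2 (norm_nonneg _) hQp.le
      _ = _ := by ring
  have hin : ∀ (p e : F), ‖p‖ < ρ → |inner ℝ p e| ≤ ρ * ‖e‖ := fun p e hp =>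
    (abs_real_inner_le_norm p e).trans (mul_le_mul_of_nonneg_right hp.le (norm_nonneg e))
  refine ⟨a, b, innerB F p1 + (2:ℝ) • Bq (a0 - b0) + (η / 2) • innerB F a0,
    innerB F p2 - (2:ℝ) • Bq (a0 - b0) + (η / 2) • innerB F b0,
    B1 + (2:ℝ) • Bq + η • innerB F, B2 + (2:ℝ) • Bq + η • innerB F,
    by linarith, by linarith, ?_, ?_, ?_, ?_, ?_⟩
  · intro e
    have q1 := abs_le.mp (hBe e)
    have q2 := abs_le.mp (hin p1 e np1)
    have q3 := abs_le.mp (hin a0 e na)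
    have q4 := mul_le_mul_of_nonneg_right hρl (norm_nonneg e)
    change |inner ℝ p1 e + 2 * Bq (a0 - b0) e + η / 2 * inner ℝ a0 e| ≤ _
    have q5 := mul_le_mul_of_nonneg_left q3.1 (half_pos hη).le
    have q6 := mul_le_mul_of_nonneg_left q3.2 (half_pos hη).le
    rw [abs_le]
    constructor <;> linarith
  · intro e
    have q1 := abs_le.mp (hBe e)
    have q2 := abs_le.mp (hin p2 e np2)
    have q3 := abs_le.mp (hin b0 e nb)
    have q4 := mul_le_mul_of_nonneg_right hρl (norm_nonneg e)
    change |inner ℝ p2 e - 2 * Bq (a0 - b0) e + η / 2 * inner ℝ b0 e| ≤ _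
    have q5 := mul_le_mul_of_nonneg_left q3.1 (half_pos hη).le
    have q6 := mul_le_mul_of_nonneg_left q3.2 (half_pos hη).le
    rw [abs_le]
    constructor <;> linarith
  · filter_upwards [t1, x1 (η / 4) (by positivity)] with e q1 q2
    change _ ≤ _ + (inner ℝ p1 e + 2 * Bq (a0 - b0) e + η / 2 * inner ℝ a0 e)
      + 1 / 2 * (B1 e e + 2 * Bq e e + η * inner ℝ e e)
    rw [real_inner_self_eq_norm_sq]
    linarith
  · filter_upwards [t2, x2 (η / 4) (by positivity)] with e q1 q2
    change _ ≤ _ + (inner ℝ p2 e - 2 * Bq (a0 - b0) e + η / 2 * inner ℝ b0 e)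
      + 1 / 2 * (B2 e e + 2 * Bq e e + η * inner ℝ e e)
    rw [real_inner_self_eq_norm_sq]
    linarith
  · intro h k
    change (B1 h h + 2 * Bq h h + η * inner ℝ h h) + (B2 k k + 2 * Bq k k + η * inner ℝ k k) ≤ _
    rw [real_inner_self_eq_norm_sq, real_inner_self_eq_norm_sq]
    have q1 := hB h k
    have q2 := quad_add Bq hs h (-k)
    simp only [map_neg, ContinuousLinearMap.neg_apply, ← sub_eq_add_neg] at q2
    linarith

/-- Theorem on sums (approximate version). -/
theorem theorem_on_sums {E : Type*} [NormedAddCommGroup E] [NormedSpace ℝ E] (L : F ≃L[ℝ] E)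
    (K : Set E) (U V : E → ℝ) (cU : ContinuousOn U K) (cV : ContinuousOn V K)
    (z1 z2 : E) (hK1 : K ∈ 𝓝 z1) (hK2 : K ∈ 𝓝 z2)
    (Bq : E →L[ℝ] E →L[ℝ] ℝ) (hs : ∀ x y, Bq x y = Bq y x) (hn : ∀ x, 0 ≤ Bq x x)
    (hle : ∀ a ∈ K, ∀ b ∈ K, U a - V b - 1 / 2 * Bq (a - b) (a - b) ≤
      U z1 - V z2 - 1 / 2 * Bq (z1 - z2) (z1 - z2)) (η : ℝ) (hη : 0 < η) :
    ∃ a b : E, ∃ l1 l2 : E →L[ℝ] ℝ, ∃ S1 S2 : E →L[ℝ] E →L[ℝ] ℝ,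
      ‖a - z1‖ < η ∧ ‖b - z2‖ < η ∧ (∀ e, |l1 e - Bq (z1 - z2) e| ≤ η * ‖e‖) ∧
      (∀ e, |l2 e - Bq (z1 - z2) e| ≤ η * ‖e‖) ∧
      (∀ᶠ e in 𝓝 (0:E), U (a + e) ≤ U a + l1 e + 1 / 2 * S1 e e) ∧
      (∀ᶠ e in 𝓝 (0:E), V b + l2 e + 1 / 2 * S2 e e ≤ V (b + e)) ∧
      ∀ h k, S1 h h - S2 k k ≤ 2 * Bq (h - k) (h - k) + η * (‖h‖ ^ 2 + ‖k‖ ^ 2) := by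
  have T : ∀ z : E, Tendsto (fun h : F => z + L h) (𝓝 0) (𝓝 z) := by
    intro z
    have h : Tendsto (fun h : F => z + L h) (𝓝 0) (𝓝 (z + L 0)) :=
      (continuous_const.add L.continuous).tendsto 0
    rwa [map_zero, add_zero] at h
  obtain ⟨r, hr, hrK⟩ := Metric.nhds_basis_closedBall.mem_iff.mp
    (inter_mem ((T z1) hK1) ((T z2) hK2))
  let q := Bq (z1 - z2)
  set BF : F →L[ℝ] F →L[ℝ] ℝ := Bq.bilinearComp (L : F →L[ℝ] E) (L : F →L[ℝ] E) with hBF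
  have hBFa : ∀ x y, BF x y = Bq (L x) (L y) := fun x y => rfl
  set C1 := ‖(L : F →L[ℝ] E)‖ with hC1
  set C2 := ‖(L.symm : E →L[ℝ] F)‖ with hC2
  have hL : ∀ x, ‖L x‖ ≤ C1 * ‖x‖ := fun x => (L : F →L[ℝ] E).le_opNorm x
  have hLs : ∀ x, ‖L.symm x‖ ≤ C2 * ‖x‖ := fun x => (L.symm : E →L[ℝ] F).le_opNorm x
  have hC1n : 0 ≤ C1 := norm_nonneg _
  have hC2n : 0 ≤ C2 := norm_nonneg _
  set η' := η / (1 + C1 + C2 + C2 ^ 2) with hη'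
  have hη'p : 0 < η' := by positivity
  have hη'e : (1 + C1 + C2 + C2 ^ 2) * η' = η := by rw [hη']; field_simp
  obtain ⟨a, b, l1, l2, S1, S2, na, nb, b1, b2, t1, t2, hS⟩ := sums_core
    (fun h => U (z1 + L h) - U z1 - q (L h)) (fun k => -(V (z2 + L k) - V z2 - q (L k))) r hr
    (by
      have : ContinuousOn (fun h => U (z1 + L h)) (Metric.closedBall (0:F) r) :=
        cU.comp (by fun_prop) (fun h hh => (hrK hh).1)
      exact (this.sub continuousOn_const).sub (by fun_prop))
    (by
      have : ContinuousOn (fun h => V (z2 + L h)) (Metric.closedBall (0:F) r) :=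
        cV.comp (by fun_prop) (fun h hh => (hrK hh).2)
      exact ((this.sub continuousOn_const).sub (by fun_prop)).neg)
    (by simp) (by simp) BF (fun x y => by rw [hBFa, hBFa, hs]) (fun x => by rw [hBFa]; exact hn _)
    (by
      intro h hh k hk
      have := hle _ (hrK hh).1 _ (hrK hk).2
      have e : z1 + L h - (z2 + L k) = (z1 - z2) + (L h - L k) := by abel
      simp only [e, map_add, map_sub, ContinuousLinearMap.add_apply,
        ContinuousLinearMap.sub_apply] at this
      simp only [hBFa, map_sub, q, ContinuousLinearMap.sub_apply]
      have s1 := hs (L h) z1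
      have s2 := hs (L h) z2
      have s3 := hs (L k) z1
      have s4 := hs (L k) z2
      linarith) η' hη'p
  have Ts : Tendsto (fun e : E => L.symm e) (𝓝 0) (𝓝 0) := by
    have h : Tendsto (fun h : E => L.symm h) (𝓝 0) (𝓝 (L.symm 0)) := (L.symm.continuous).tendsto 0
    rwa [map_zero] at h
  have hlb : ∀ (l : F →L[ℝ] ℝ), (∀ e, |l e| ≤ η' * ‖e‖) → ∀ e, |l (L.symm e)| ≤ η * ‖e‖ := by
    intro l hl e
    refine (hl _).trans ?_
    calc η' * ‖L.symm e‖ ≤ η' * (C2 * ‖e‖) := mul_le_mul_of_nonneg_left (hLs e) hη'p.le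
      _ = (C2 * η') * ‖e‖ := by ring
      _ ≤ _ := mul_le_mul_of_nonneg_right (by nlinarith [sq_nonneg C2]) (norm_nonneg e)
  have hnb : ∀ a : F, ‖a‖ < η' → ‖L a‖ < η := by
    intro a ha
    have := hL a
    nlinarith [sq_nonneg C2, mul_nonneg hC2n hη'p.le, mul_nonneg (sq_nonneg C2) hη'p.le]
  refine ⟨z1 + L a, z2 + L b, q + l1.comp (L.symm : E →L[ℝ] F), q - l2.comp (L.symm : E →L[ℝ] F),
    S1.bilinearComp (L.symm : E →L[ℝ] F) (L.symm : E →L[ℝ] F),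
    -(S2.bilinearComp (L.symm : E →L[ℝ] F) (L.symm : E →L[ℝ] F)), ?_, ?_, ?_, ?_, ?_, ?_, ?_⟩
  · rw [add_sub_cancel_left]; exact hnb a na
  · rw [add_sub_cancel_left]; exact hnb b nb
  · intro e
    have := hlb l1 b1 e
    change |q e + l1 (L.symm e) - q e| ≤ _
    rwa [add_sub_cancel_left]
  · intro e
    have := hlb l2 b2 e
    change |q e - l2 (L.symm e) - q e| ≤ _
    rwa [sub_sub_cancel_left, abs_neg]
  · filter_upwards [Ts.eventually t1] with e he
    simp only [map_add, L.apply_symm_apply, ← add_assoc] at he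
    change _ ≤ _ + (q e + l1 (L.symm e)) + 1 / 2 * S1 (L.symm e) (L.symm e)
    linarith
  · filter_upwards [Ts.eventually t2] with e he
    simp only [map_add, L.apply_symm_apply, ← add_assoc] at he
    change _ + (q e - l2 (L.symm e)) + 1 / 2 * -(S2 (L.symm e) (L.symm e)) ≤ _
    linarith
  · intro h k
    have q1 := hS (L.symm h) (L.symm k)
    rw [hBFa, map_sub, L.apply_symm_apply, L.apply_symm_apply] at q1
    change S1 (L.symm h) (L.symm h) - -(S2 (L.symm k) (L.symm k)) ≤ _
    have q2 : ∀ h, η' * ‖L.symm h‖ ^ 2 ≤ η * ‖h‖ ^ 2 := by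
      intro h
      calc η' * ‖L.symm h‖ ^ 2 ≤ η' * (C2 * ‖h‖) ^ 2 := by gcongr; exact hLs h
        _ = (C2 ^ 2 * η') * ‖h‖ ^ 2 := by ring
        _ ≤ _ := mul_le_mul_of_nonneg_right (by nlinarith [mul_nonneg hC2n hη'p.le]) (sq_nonneg _)
    have := q2 h
    have := q2 k
    linarith
end
end
end

section
open Set Filter Topology

noncomputable section
section
variable {F : Type*} [NormedAddCommGroup F] [InnerProductSpace ℝ F] [FiniteDimensional ℝ F]

/-- Consequence of the theorem on sums for second order operators written with jets. -/
theorem jets_ineq {E : Type*} [NormedAddCommGroup E] [NormedSpace ℝ E] (L : F ≃L[ℝ] E) {d : ℕ}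
    (K : Set E) (U V : E → ℝ) (cU : ContinuousOn U K) (cV : ContinuousOn V K)
    (z1 z2 : E) (hK1 : K ∈ 𝓝 z1) (hK2 : K ∈ 𝓝 z2)
    (Bq : E →L[ℝ] E →L[ℝ] ℝ) (hs : ∀ x y, Bq x y = Bq y x) (hn : ∀ x, 0 ≤ Bq x x)
    (hle : ∀ a ∈ K, ∀ b ∈ K, U a - V b - 1 / 2 * Bq (a - b) (a - b) ≤
      U z1 - V z2 - 1 / 2 * Bq (z1 - z2) (z1 - z2))
    (β : E → E) (s : Fin d → E → E) (f : E → ℝ) (c0 : ℝ)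
    (cβ : ContinuousOn β K) (cs : ∀ r, ContinuousOn (s r) K) (cf : ContinuousOn f K)
    (hsub : ∀ a ∈ K, ∀ (l : E →L[ℝ] ℝ) (S : E →L[ℝ] E →L[ℝ] ℝ),
      (∀ᶠ e in 𝓝 (0:E), U (a + e) ≤ U a + l e + 1 / 2 * S e e) →
      c0 ≤ l (β a) + 1 / 2 * ∑ r, S (s r a) (s r a) + f a)
    (hsup : ∀ a ∈ K, ∀ (l : E →L[ℝ] ℝ) (S : E →L[ℝ] E →L[ℝ] ℝ),
      (∀ᶠ e in 𝓝 (0:E), V a + l e + 1 / 2 * S e e ≤ V (a + e)) →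
      l (β a) + 1 / 2 * ∑ r, S (s r a) (s r a) + f a ≤ 0) :
    c0 ≤ Bq (z1 - z2) (β z1 - β z2) + ∑ r, Bq (s r z1 - s r z2) (s r z1 - s r z2)
      + (f z1 - f z2) := by
  choose a b l1 l2 S1 S2 na nb b1 b2 t1 t2 hS using fun n : ℕ =>
    theorem_on_sums L K U V cU cV z1 z2 hK1 hK2 Bq hs hn hle (1 / ((n:ℝ) + 1)) (by positivity)
  have hη : Tendsto (fun n : ℕ => 1 / ((n:ℝ) + 1)) atTop (𝓝 0) :=
    tendsto_one_div_add_atTop_nhds_zero_nat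
  have ha : Tendsto a atTop (𝓝 z1) :=
    tendsto_iff_norm_sub_tendsto_zero.mpr
      (squeeze_zero (fun _ => norm_nonneg _) (fun n => (na n).le) hη)
  have hb : Tendsto b atTop (𝓝 z2) :=
    tendsto_iff_norm_sub_tendsto_zero.mpr
      (squeeze_zero (fun _ => norm_nonneg _) (fun n => (nb n).le) hη)
  have hβa := (cβ.continuousAt hK1).tendsto.comp ha
  have hβb := (cβ.continuousAt hK2).tendsto.comp hb
  have hsa := fun r => ((cs r).continuousAt hK1).tendsto.comp ha
  have hsb := fun r => ((cs r).continuousAt hK2).tendsto.comp hb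
  have hfa := (cf.continuousAt hK1).tendsto.comp ha
  have hfb := (cf.continuousAt hK2).tendsto.comp hb
  have hquad : Continuous (fun x : E => Bq x x) := by fun_prop
  have hlin : Continuous (fun x : E => Bq (z1 - z2) x) := by fun_prop
  have lim : Tendsto (fun n => Bq (z1 - z2) (β (a n) - β (b n))
      + ∑ r, Bq (s r (a n) - s r (b n)) (s r (a n) - s r (b n)) + (f (a n) - f (b n))
      + 1 / ((n:ℝ) + 1) * (‖β (a n)‖ + ‖β (b n)‖
        + 1 / 2 * ∑ r, (‖s r (a n)‖ ^ 2 + ‖s r (b n)‖ ^ 2))) atTop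
      (𝓝 (Bq (z1 - z2) (β z1 - β z2) + ∑ r, Bq (s r z1 - s r z2) (s r z1 - s r z2)
      + (f z1 - f z2) + 0 * (‖β z1‖ + ‖β z2‖
        + 1 / 2 * ∑ r, (‖s r z1‖ ^ 2 + ‖s r z2‖ ^ 2)))) := by
    refine Tendsto.add (Tendsto.add (Tendsto.add ?_ ?_) ?_) (Tendsto.mul hη ?_)
    · exact (hlin.tendsto _).comp (hβa.sub hβb)
    · exact tendsto_finsetSum _ fun r _ => (hquad.tendsto _).comp ((hsa r).sub (hsb r))
    · exact hfa.sub hfb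
    · exact (hβa.norm.add hβb.norm).add (tendsto_const_nhds.mul
        (tendsto_finsetSum _ fun r _ => ((hsa r).norm.pow 2).add ((hsb r).norm.pow 2)))
  rw [zero_mul, add_zero] at lim
  refine ge_of_tendsto lim ?_
  filter_upwards [ha hK1, hb hK2] with n haK hbK
  have q1 := hsub (a n) haK (l1 n) (S1 n) (t1 n)
  have q2 := hsup (b n) hbK (l2 n) (S2 n) (t2 n)
  have q3 := (abs_le.mp (b1 n (β (a n)))).2
  have q4 := (abs_le.mp (b2 n (β (b n)))).1
  have q5 : ∑ r, S1 n (s r (a n)) (s r (a n)) - ∑ r, S2 n (s r (b n)) (s r (b n)) ≤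
      2 * ∑ r, Bq (s r (a n) - s r (b n)) (s r (a n) - s r (b n))
      + 1 / ((n:ℝ) + 1) * ∑ r, (‖s r (a n)‖ ^ 2 + ‖s r (b n)‖ ^ 2) := by
    rw [← Finset.sum_sub_distrib, Finset.mul_sum, Finset.mul_sum, ← Finset.sum_add_distrib]
    exact Finset.sum_le_sum fun r _ => hS n _ _
  rw [map_sub]
  linarith
end
end
end

section
open Set Filter Topology

noncomputable section
section
variable {G : Type*} [NormedAddCommGroup G] [InnerProductSpace ℝ G] [FiniteDimensional ℝ G]

/-- the penalizing quadratic form -/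
def penB (G : Type*) [NormedAddCommGroup G] [InnerProductSpace ℝ G] (δ ε : ℝ) :
    (ℝ × G) →L[ℝ] (ℝ × G) →L[ℝ] ℝ :=
  (1 / δ) • (innerB ℝ).bilinearComp (ContinuousLinearMap.fst ℝ ℝ G) (ContinuousLinearMap.fst ℝ ℝ G)
  + (1 / ε) • (innerB G).bilinearComp (ContinuousLinearMap.snd ℝ ℝ G)
    (ContinuousLinearMap.snd ℝ ℝ G)

theorem penB_apply (δ ε : ℝ) (h k : ℝ × G) :
    penB G δ ε h k = 1 / δ * inner ℝ h.1 k.1 + 1 / ε * inner ℝ h.2 k.2 := rfl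

theorem penB_self (δ ε : ℝ) (h : ℝ × G) :
    penB G δ ε h h = 1 / δ * h.1 ^ 2 + 1 / ε * ‖h.2‖ ^ 2 := by
  rw [penB_apply, real_inner_self_eq_norm_sq, real_inner_self_eq_norm_sq, Real.norm_eq_abs, sq_abs]

theorem aux_b (C D w : ℝ) : D * (C * D + w) ≤ (C + 1) * D ^ 2 + w ^ 2 := by
  nlinarith [sq_nonneg (D - w), sq_nonneg D, sq_nonneg w]

theorem aux_s (C D w : ℝ) : (C * D + w) ^ 2 ≤ 2 * C ^ 2 * D ^ 2 + 2 * w ^ 2 := by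
  nlinarith [sq_nonneg (C * D - w)]

set_option maxHeartbeats 1000000 in
theorem no_max {d : ℕ} (zb : ℝ × G) (r : ℝ) (hr : 0 < r)
    (U V : ℝ × G → ℝ) (cU : ContinuousOn U (Metric.closedBall zb r))
    (cV : ContinuousOn V (Metric.closedBall zb r)) (κ : ℝ) (hκ : 0 < κ)
    (hmax : ∀ z ∈ Metric.closedBall zb r, U z - V z + κ * ‖z - zb‖ ^ 2 ≤ U zb - V zb)
    (b : ℝ × G → G) (s : Fin d → ℝ × G → G) (f : ℝ × G → ℝ) (c0 : ℝ) (hc0 : 0 < c0)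
    (cb : ContinuousOn b (Metric.closedBall zb r))
    (cs : ∀ i, ContinuousOn (s i) (Metric.closedBall zb r))
    (cf : ContinuousOn f (Metric.closedBall zb r))
    (C : ℝ) (hC : 0 ≤ C)
    (lb : ∀ t x x', (t, x) ∈ Metric.closedBall zb r → (t, x') ∈ Metric.closedBall zb r →
      ‖b (t, x) - b (t, x')‖ ≤ C * ‖x - x'‖)
    (ls : ∀ i t x x', (t, x) ∈ Metric.closedBall zb r → (t, x') ∈ Metric.closedBall zb r →
      ‖s i (t, x) - s i (t, x')‖ ≤ C * ‖x - x'‖)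
    (hsub : ∀ a ∈ Metric.closedBall zb r, ∀ (l : ℝ × G →L[ℝ] ℝ)
      (S : (ℝ × G) →L[ℝ] (ℝ × G) →L[ℝ] ℝ),
      (∀ᶠ e in 𝓝 (0:ℝ × G), U (a + e) ≤ U a + l e + 1 / 2 * S e e) →
      c0 ≤ l (1, b a) + 1 / 2 * ∑ i, S (0, s i a) (0, s i a) + f a)
    (hsup : ∀ a ∈ Metric.closedBall zb r, ∀ (l : ℝ × G →L[ℝ] ℝ)
      (S : (ℝ × G) →L[ℝ] (ℝ × G) →L[ℝ] ℝ),
      (∀ᶠ e in 𝓝 (0:ℝ × G), V a + l e + 1 / 2 * S e e ≤ V (a + e)) →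
      l (1, b a) + 1 / 2 * ∑ i, S (0, s i a) (0, s i a) + f a ≤ 0) : False := by
  set K := Metric.closedBall zb r with hK
  have hKc : IsCompact K := isCompact_closedBall _ _
  have hzb : zb ∈ K := Metric.mem_closedBall_self hr.le
  set A : ℝ := C + 1 + 2 * d * C ^ 2 with hA
  have hAp : 0 < A := by positivity
  set Bc : ℝ := 1 + 2 * d with hBc
  have hBp : 0 < Bc := by positivity
  set μ := min (c0 / (8 * A)) (κ * r ^ 2 / 8) with hμ
  have hμp : 0 < μ := by positivity
  have hμ1 : 2 * A * μ ≤ c0 / 4 := by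
    have : μ ≤ c0 / (8 * A) := min_le_left _ _
    rw [le_div_iff₀ (by positivity)] at this
    linarith
  have hμ2 : μ < κ * (r / 2) ^ 2 := by
    have : μ ≤ κ * r ^ 2 / 8 := min_le_right _ _
    have : 0 < κ * r ^ 2 := by positivity
    linarith
  obtain ⟨τV, hτV, uV⟩ := Metric.uniformContinuousOn_iff.mp
    (hKc.uniformContinuousOn_of_continuous cV) μ hμp
  obtain ⟨τf, hτf, uf⟩ := Metric.uniformContinuousOn_iff.mp
    (hKc.uniformContinuousOn_of_continuous cf) (c0 / 4) (by positivity)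
  obtain ⟨M0, hM0⟩ := hKc.exists_bound_of_continuousOn cV
  set M := |M0| + 1 with hM
  have hMp : 0 < M := by positivity
  have hMb : ∀ z ∈ K, |V z| ≤ M := fun z hz => by
    have := hM0 z hz
    rw [Real.norm_eq_abs] at this
    linarith [le_abs_self M0]
  set τ := min (min τV τf) (r / 2) with hτ
  have hτp : 0 < τ := by positivity
  set ε := τ ^ 2 / (8 * M) with hε
  have hεp : 0 < ε := by positivity
  have hεe : 8 * M * ε = τ ^ 2 := by rw [hε]; field_simp
  set w := min 1 (c0 * ε / (4 * Bc)) with hw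
  have hwp : 0 < w := by positivity
  have hw2 : 1 / ε * (Bc * w ^ 2) ≤ c0 / 4 := by
    have h1 : w ≤ 1 := min_le_left _ _
    have h2 : w ≤ c0 * ε / (4 * Bc) := min_le_right _ _
    have h3 : w ^ 2 ≤ c0 * ε / (4 * Bc) := by nlinarith
    rw [le_div_iff₀ (by positivity)] at h3
    rw [one_div_mul_eq_div, div_le_iff₀ hεp]
    linarith
  obtain ⟨τb, hτb, ub⟩ := Metric.uniformContinuousOn_iff.mp
    (hKc.uniformContinuousOn_of_continuous cb) w hwp
  obtain ⟨τs, hτs, us⟩ := Metric.uniformContinuousOn_iff.mp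
    (hKc.uniformContinuousOn_of_continuous (continuousOn_pi.mpr cs)) w hwp
  set τ2 := min τ (min τb τs) with hτ2
  have hτpos : 0 < τ2 := by positivity
  set δ := τ2 ^ 2 / (8 * M) with hδ
  have hδp : 0 < δ := by positivity
  have hδe : 8 * M * δ = τ2 ^ 2 := by rw [hδ]; field_simp
  -- maximize
  obtain ⟨⟨z1, z2⟩, hz, hzmax⟩ := (hKc.prod hKc).exists_isMaxOn ⟨(zb, zb), hzb, hzb⟩
    (f := fun p : (ℝ × G) × (ℝ × G) => U p.1 - V p.2 - 1 / 2 * penB G δ ε (p.1 - p.2) (p.1 - p.2))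
    (by
      have h1 : ContinuousOn (fun p : (ℝ × G) × (ℝ × G) => U p.1) (K ×ˢ K) :=
        cU.comp continuousOn_fst (fun p hp => hp.1)
      have h2 : ContinuousOn (fun p : (ℝ × G) × (ℝ × G) => V p.2) (K ×ˢ K) :=
        cV.comp continuousOn_snd (fun p hp => hp.2)
      exact (h1.sub h2).sub (by fun_prop))
  have hz1 : z1 ∈ K := hz.1
  have hz2 : z2 ∈ K := hz.2
  have hle : ∀ a ∈ K, ∀ b ∈ K, U a - V b - 1 / 2 * penB G δ ε (a - b) (a - b) ≤
      U z1 - V z2 - 1 / 2 * penB G δ ε (z1 - z2) (z1 - z2) := fun a ha b hb =>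
    hzmax (⟨ha, hb⟩ : (a, b) ∈ K ×ˢ K)
  have e1 := hle zb hzb zb hzb
  simp only [sub_self, map_zero] at e1
  have e2 := hmax z1 hz1
  rw [penB_self] at e1
  have e3 : 1 / 2 * (1 / δ * (z1 - z2).1 ^ 2 + 1 / ε * ‖(z1 - z2).2‖ ^ 2) + κ * ‖z1 - zb‖ ^ 2 ≤
    V z1 - V z2 := by linarith
  have p1 : 0 ≤ 1 / δ * (z1 - z2).1 ^ 2 := by positivity
  have p2 : 0 ≤ 1 / ε * ‖(z1 - z2).2‖ ^ 2 := by positivity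
  have p3 : 0 ≤ κ * ‖z1 - zb‖ ^ 2 := by positivity
  have e4 : V z1 - V z2 ≤ 2 * M := by
    have := abs_le.mp (hMb z1 hz1)
    have := abs_le.mp (hMb z2 hz2)
    linarith
  have d1 : |(z1 - z2).1| < τ2 := by
    have : 1 / δ * (z1 - z2).1 ^ 2 ≤ 4 * M := by linarith
    rw [one_div_mul_eq_div, div_le_iff₀ hδp] at this
    refine abs_lt_of_sq_lt_sq ?_ hτpos.le
    have : 0 < τ2 ^ 2 := by positivity
    linarith
  have d2 : ‖(z1 - z2).2‖ < τ := by
    have : 1 / ε * ‖(z1 - z2).2‖ ^ 2 ≤ 4 * M := by linarith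
    rw [one_div_mul_eq_div, div_le_iff₀ hεp] at this
    refine lt_of_pow_lt_pow_left₀ 2 hτp.le ?_
    have : 0 < τ ^ 2 := by positivity
    linarith
  have hττ : τ2 ≤ τ := min_le_left _ _
  have d3 : dist z1 z2 < τ := by
    rw [dist_eq_norm, Prod.norm_def]
    exact max_lt (d1.trans_le hττ) d2
  have e5 := uV z1 hz1 z2 hz2 (d3.trans_le ((min_le_left _ _).trans (min_le_left _ _)))
  have e6 := uf z1 hz1 z2 hz2 (d3.trans_le ((min_le_left _ _).trans (min_le_right _ _)))
  rw [Real.dist_eq] at e5 e6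
  have e5 := (abs_lt.mp e5).2
  have e6 := (abs_lt.mp e6).2
  have e7 : ‖z1 - zb‖ < r / 2 := by
    have : κ * ‖z1 - zb‖ ^ 2 < κ * (r / 2) ^ 2 := by linarith
    exact lt_of_pow_lt_pow_left₀ 2 (by positivity) (lt_of_mul_lt_mul_left this hκ.le)
  rw [← dist_eq_norm] at e7
  have e8 : dist z2 zb < r := by
    have h1 := dist_triangle z2 z1 zb
    rw [dist_comm z2 z1] at h1
    have : τ ≤ r / 2 := min_le_right _ _
    linarith
  have hK1 : K ∈ 𝓝 z1 := Metric.closedBall_mem_nhds_of_mem (by rw [Metric.mem_ball]; linarith)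
  have hK2 : K ∈ 𝓝 z2 := Metric.closedBall_mem_nhds_of_mem (by rw [Metric.mem_ball]; linarith)
  have key := jets_ineq (WithLp.prodContinuousLinearEquiv 2 ℝ ℝ G) K U V cU cV z1 z2 hK1 hK2
    (penB G δ ε) (fun x y => by
      rw [penB_apply, penB_apply, real_inner_comm, real_inner_comm x.2])
    (fun x => by rw [penB_self]; positivity) hle (fun z => (1, b z)) (fun i z => (0, s i z)) f c0
    (continuousOn_const.prodMk cb) (fun i => continuousOn_const.prodMk (cs i)) cf hsub hsup
  -- intermediate point
  obtain ⟨t1, x1⟩ := z1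
  obtain ⟨t2, x2⟩ := z2
  obtain ⟨tb, xb⟩ := zb
  have hzi : (t1, x2) ∈ K := by
    rw [hK, Metric.mem_closedBall, Prod.dist_eq] at hz1 hz2 ⊢
    exact max_le ((le_max_left _ _).trans hz1) ((le_max_right _ _).trans hz2)
  have di : dist (t1, x2) (t2, x2) < min τb τs := by
    rw [Prod.dist_eq]
    simp only [dist_self]
    refine max_lt ?_ (by positivity)
    exact d1.trans_le (min_le_right _ _)
  simp only [Prod.mk_sub_mk] at *
  set D := ‖x1 - x2‖ with hD
  have hDn : 0 ≤ D := norm_nonneg _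
  have bb : ‖b (t1, x1) - b (t2, x2)‖ ≤ C * D + w := by
    have h1 := lb t1 x1 x2 hz1 hzi
    have h2 := ub _ hzi _ hz2 (di.trans_le (min_le_left _ _))
    rw [dist_eq_norm] at h2
    exact (norm_sub_le_norm_sub_add_norm_sub _ (b (t1, x2)) _).trans (by linarith)
  have bs : ∀ i, ‖s i (t1, x1) - s i (t2, x2)‖ ≤ C * D + w := by
    intro i
    have h1 := ls i t1 x1 x2 hz1 hzi
    have h2 := (dist_le_pi_dist _ _ i).trans_lt
      (us _ hzi _ hz2 (di.trans_le (min_le_right _ _)))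
    rw [dist_eq_norm] at h2
    exact (norm_sub_le_norm_sub_add_norm_sub _ (s i (t1, x2)) _).trans (by linarith)
  have k1 : penB G δ ε (t1 - t2, x1 - x2) ((1:ℝ) - 1, b (t1, x1) - b (t2, x2)) ≤
      1 / ε * ((C + 1) * D ^ 2 + w ^ 2) := by
    rw [penB_apply]
    simp only [sub_self, inner_zero_right, mul_zero, zero_add]
    refine mul_le_mul_of_nonneg_left ?_ (by positivity)
    refine (real_inner_le_norm _ _).trans ?_
    refine (mul_le_mul_of_nonneg_left bb hDn).trans ?_
    exact aux_b C D w
  have k2 : ∑ i, penB G δ ε ((0:ℝ) - 0, s i (t1, x1) - s i (t2, x2))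
      ((0:ℝ) - 0, s i (t1, x1) - s i (t2, x2)) ≤ d * (1 / ε * (2 * C ^ 2 * D ^ 2 + 2 * w ^ 2)) := by
    have : ∀ i ∈ Finset.univ, penB G δ ε ((0:ℝ) - 0, s i (t1, x1) - s i (t2, x2))
      ((0:ℝ) - 0, s i (t1, x1) - s i (t2, x2)) ≤ 1 / ε * (2 * C ^ 2 * D ^ 2 + 2 * w ^ 2) := by
      intro i _
      rw [penB_self]
      simp only [sub_self, ne_eq, OfNat.ofNat_ne_zero, not_false_eq_true, zero_pow, mul_zero,
        zero_add]
      refine mul_le_mul_of_nonneg_left ?_ (by positivity)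
      have h1 := pow_le_pow_left₀ (norm_nonneg _) (bs i) 2
      exact h1.trans (aux_s C D w)
    have h2 := Finset.sum_le_card_nsmul _ _ _ this
    simpa using h2
  have k3 : 1 / ε * D ^ 2 ≤ 2 * μ := by linarith
  have k4 := mul_le_mul_of_nonneg_left k3 hAp.le
  have k5 : 1 / ε * ((C + 1) * D ^ 2 + w ^ 2) + d * (1 / ε * (2 * C ^ 2 * D ^ 2 + 2 * w ^ 2)) =
      A * (1 / ε * D ^ 2) + 1 / ε * (Bc * w ^ 2) := by rw [hA, hBc]; ring
  have k6 := key.trans (add_le_add (add_le_add k1 k2) e6.le)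
  linarith
end
end
end

section
open Set Filter Topology

noncomputable section
namespace SwitchingPDE
section
variable {k d : ℕ}

/-- column `r` of the diffusion matrix -/
def col (σ : ℝ → EuclideanSpace ℝ (Fin k) → Fin k → Fin d → ℝ) (r : Fin d)
    (z : ℝ × EuclideanSpace ℝ (Fin k)) : EuclideanSpace ℝ (Fin k) :=
  WithLp.toLp 2 (fun p => σ z.1 z.2 p r)

/-- the parabolic operator -/
def Lop (σ : ℝ → EuclideanSpace ℝ (Fin k) → Fin k → Fin d → ℝ)
    (b : ℝ → EuclideanSpace ℝ (Fin k) → EuclideanSpace ℝ (Fin k))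
    (φ : ℝ × EuclideanSpace ℝ (Fin k) → ℝ) (z : ℝ × EuclideanSpace ℝ (Fin k)) : ℝ :=
  dt φ z.1 z.2 + opA σ b φ z.1 z.2

theorem col_eq (σ : ℝ → EuclideanSpace ℝ (Fin k) → Fin k → Fin d → ℝ) (r : Fin d)
    (z : ℝ × EuclideanSpace ℝ (Fin k)) :
    ((0, col σ r z) : ℝ × EuclideanSpace ℝ (Fin k)) =
      ∑ p, σ z.1 z.2 p r • ((0, EuclideanSpace.single p 1) : ℝ × EuclideanSpace ℝ (Fin k)) := by
  refine Prod.ext ?_ ?_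
  · simp [Prod.fst_sum]
  · rw [Prod.snd_sum]
    simp only [Prod.smul_mk]
    ext q
    simp [col, Pi.single_apply]

theorem Lop_eq (σ : ℝ → EuclideanSpace ℝ (Fin k) → Fin k → Fin d → ℝ)
    (b : ℝ → EuclideanSpace ℝ (Fin k) → EuclideanSpace ℝ (Fin k))
    (φ : ℝ × EuclideanSpace ℝ (Fin k) → ℝ) (hφ : ContDiff ℝ 2 φ)
    (z : ℝ × EuclideanSpace ℝ (Fin k)) :
    Lop σ b φ z = fderiv ℝ φ z (1, b z.1 z.2)
      + 1 / 2 * ∑ r, fderiv ℝ (fderiv ℝ φ) z (0, col σ r z) (0, col σ r z) := by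
  have hd : Differentiable ℝ (fderiv ℝ φ) :=
    (hφ.fderiv_right (m := 1) (by norm_num)).differentiable (by norm_num)
  have h2 : ∀ v w, fderiv ℝ (fun y => fderiv ℝ φ y w) z v = fderiv ℝ (fderiv ℝ φ) z v w := by
    intro v w
    rw [fderiv_clm_apply (hd z) (differentiableAt_const w)]
    simp
  have h3 : ∀ r, fderiv ℝ (fderiv ℝ φ) z (0, col σ r z) (0, col σ r z) =
      ∑ p, ∑ q, (σ z.1 z.2 p r * σ z.1 z.2 q r) *
        fderiv ℝ (fderiv ℝ φ) z (0, EuclideanSpace.single p 1) (0, EuclideanSpace.single q 1) := by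
    intro r
    rw [col_eq]
    simp only [map_sum, map_smul, ContinuousLinearMap.sum_apply, ContinuousLinearMap.smul_apply,
      smul_eq_mul, Finset.mul_sum, mul_assoc]
    rw [Finset.sum_comm]
    refine Finset.sum_congr rfl fun p _ => Finset.sum_congr rfl fun q _ => ?_
    ring
  have h4 : ((1, b z.1 z.2) : ℝ × EuclideanSpace ℝ (Fin k)) = (1, 0) + (0, b z.1 z.2) := by simp
  rw [h4, map_add]
  unfold Lop dt opA
  simp only [h3, Prod.mk.eta, h2]
  have h5 : ∑ r : Fin d, ∑ p, ∑ q, (σ z.1 z.2 p r * σ z.1 z.2 q r) *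
        fderiv ℝ (fderiv ℝ φ) z (0, EuclideanSpace.single p 1) (0, EuclideanSpace.single q 1) =
      ∑ p, ∑ q, (∑ r : Fin d, (σ z.1 z.2 p r * σ z.1 z.2 q r)) *
        fderiv ℝ (fderiv ℝ φ) z (0, EuclideanSpace.single p 1) (0, EuclideanSpace.single q 1) := by
    rw [Finset.sum_comm]
    refine Finset.sum_congr rfl fun p _ => ?_
    rw [Finset.sum_comm]
    refine Finset.sum_congr rfl fun q _ => ?_
    rw [Finset.sum_mul]
  rw [h5]
  ring

theorem Lop_add (σ : ℝ → EuclideanSpace ℝ (Fin k) → Fin k → Fin d → ℝ)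
    (b : ℝ → EuclideanSpace ℝ (Fin k) → EuclideanSpace ℝ (Fin k))
    (φ χ : ℝ × EuclideanSpace ℝ (Fin k) → ℝ) (hφ : ContDiff ℝ 2 φ) (hχ : ContDiff ℝ 2 χ)
    (z : ℝ × EuclideanSpace ℝ (Fin k)) :
    Lop σ b (fun y => φ y + χ y) z = Lop σ b φ z + Lop σ b χ z := by
  have d1 : Differentiable ℝ φ := hφ.differentiable (by norm_num)
  have d2 : Differentiable ℝ χ := hχ.differentiable (by norm_num)
  have e1 : Differentiable ℝ (fderiv ℝ φ) :=
    (hφ.fderiv_right (m := 1) (by norm_num)).differentiable (by norm_num)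
  have e2 : Differentiable ℝ (fderiv ℝ χ) :=
    (hχ.fderiv_right (m := 1) (by norm_num)).differentiable (by norm_num)
  rw [Lop_eq σ b _ (hφ.add hχ), Lop_eq σ b _ hφ, Lop_eq σ b _ hχ]
  have f1 : fderiv ℝ (fun y => φ y + χ y) = fun y => fderiv ℝ φ y + fderiv ℝ χ y := by
    funext y
    exact fderiv_fun_add (d1 y) (d2 y)
  have f2 : fderiv ℝ (fderiv ℝ (fun y => φ y + χ y)) z =
      fderiv ℝ (fderiv ℝ φ) z + fderiv ℝ (fderiv ℝ χ) z := by
    rw [f1]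
    exact fderiv_fun_add (e1 z) (e2 z)
  rw [f2, f1]
  simp only [ContinuousLinearMap.add_apply, Finset.sum_add_distrib]
  ring

theorem Lop_const_mul (σ : ℝ → EuclideanSpace ℝ (Fin k) → Fin k → Fin d → ℝ)
    (b : ℝ → EuclideanSpace ℝ (Fin k) → EuclideanSpace ℝ (Fin k))
    (φ : ℝ × EuclideanSpace ℝ (Fin k) → ℝ) (hφ : ContDiff ℝ 2 φ) (c : ℝ)
    (z : ℝ × EuclideanSpace ℝ (Fin k)) :
    Lop σ b (fun y => c * φ y) z = c * Lop σ b φ z := by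
  have d1 : Differentiable ℝ φ := hφ.differentiable (by norm_num)
  have e1 : Differentiable ℝ (fderiv ℝ φ) :=
    (hφ.fderiv_right (m := 1) (by norm_num)).differentiable (by norm_num)
  rw [Lop_eq σ b _ (contDiff_const.mul hφ), Lop_eq σ b _ hφ]
  have f1 : fderiv ℝ (fun y => c * φ y) = fun y => c • fderiv ℝ φ y := by
    funext y
    exact fderiv_const_mul (d1 y) c
  have f2 : fderiv ℝ (fderiv ℝ (fun y => c * φ y)) z = c • fderiv ℝ (fderiv ℝ φ) z := by
    rw [f1]
    exact fderiv_fun_const_smul (e1 z) c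
  rw [f2, f1]
  simp only [ContinuousLinearMap.smul_apply, smul_eq_mul, ← Finset.mul_sum]
  ring

theorem Lop_continuousOn (σ : ℝ → EuclideanSpace ℝ (Fin k) → Fin k → Fin d → ℝ)
    (b : ℝ → EuclideanSpace ℝ (Fin k) → EuclideanSpace ℝ (Fin k))
    (s : Set (ℝ × EuclideanSpace ℝ (Fin k)))
    (hσ : ∀ r, ContinuousOn (col σ r) s) (hb : ContinuousOn (fun z => b z.1 z.2) s)
    (φ : ℝ × EuclideanSpace ℝ (Fin k) → ℝ) (hφ : ContDiff ℝ 2 φ) :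
    ContinuousOn (Lop σ b φ) s := by
  have h1 : Continuous (fderiv ℝ φ) := hφ.continuous_fderiv (by norm_num)
  have h2 : Continuous (fderiv ℝ (fderiv ℝ φ)) :=
    (hφ.fderiv_right (m := 1) (by norm_num)).continuous_fderiv (by norm_num)
  have : Lop σ b φ = fun z => fderiv ℝ φ z (1, b z.1 z.2)
      + 1 / 2 * ∑ r, fderiv ℝ (fderiv ℝ φ) z (0, col σ r z) (0, col σ r z) :=
    funext fun z => Lop_eq σ b φ hφ z
  rw [this]
  refine (h1.continuousOn.clm_apply (continuousOn_const.prodMk hb)).add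
    (continuousOn_const.mul (continuousOn_finset_sum _ fun r _ => ?_))
  exact (h2.continuousOn.clm_apply (continuousOn_const.prodMk (hσ r))).clm_apply
    (continuousOn_const.prodMk (hσ r))

/-- quadratic test functions -/
def qtest (c : ℝ) (a : ℝ × EuclideanSpace ℝ (Fin k)) (l : ℝ × EuclideanSpace ℝ (Fin k) →L[ℝ] ℝ)
    (S : (ℝ × EuclideanSpace ℝ (Fin k)) →L[ℝ] (ℝ × EuclideanSpace ℝ (Fin k)) →L[ℝ] ℝ)
    (z : ℝ × EuclideanSpace ℝ (Fin k)) : ℝ :=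
  c + l (z - a) + 1 / 2 * S (z - a) (z - a)

theorem qtest_contDiff (c : ℝ) (a : ℝ × EuclideanSpace ℝ (Fin k))
    (l : ℝ × EuclideanSpace ℝ (Fin k) →L[ℝ] ℝ)
    (S : (ℝ × EuclideanSpace ℝ (Fin k)) →L[ℝ] (ℝ × EuclideanSpace ℝ (Fin k)) →L[ℝ] ℝ) :
    ContDiff ℝ 2 (qtest c a l S) := by
  unfold qtest
  have h : ContDiff ℝ 2 (fun z => z - a) := contDiff_id.sub contDiff_const
  exact (contDiff_const.add (l.contDiff.comp h)).add
    (contDiff_const.mul ((S.contDiff.comp h).clm_apply h))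

theorem Lop_qtest (σ : ℝ → EuclideanSpace ℝ (Fin k) → Fin k → Fin d → ℝ)
    (b : ℝ → EuclideanSpace ℝ (Fin k) → EuclideanSpace ℝ (Fin k))
    (c : ℝ) (a : ℝ × EuclideanSpace ℝ (Fin k))
    (l : ℝ × EuclideanSpace ℝ (Fin k) →L[ℝ] ℝ)
    (S : (ℝ × EuclideanSpace ℝ (Fin k)) →L[ℝ] (ℝ × EuclideanSpace ℝ (Fin k)) →L[ℝ] ℝ) :
    Lop σ b (qtest c a l S) a = l (1, b a.1 a.2)
      + 1 / 2 * ∑ r, S (0, col σ r a) (0, col σ r a) := by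
  rw [Lop_eq σ b _ (qtest_contDiff c a l S)]
  have f1 : ∀ y, fderiv ℝ (qtest c a l S) y = l + (1 / 2 : ℝ) • (S (y - a) + S.flip (y - a)) := by
    intro y
    refine HasFDerivAt.fderiv ?_
    have h0 : HasFDerivAt (fun z => z - a) (ContinuousLinearMap.id ℝ _) y :=
      (hasFDerivAt_id y).sub_const a
    have h1 := l.hasFDerivAt.comp y h0
    have h2 := (S.hasFDerivAt.comp y h0).clm_apply h0
    have h3 := ((hasFDerivAt_const c y).add h1).add (h2.const_mul (1 / 2))
    refine h3.congr_fderiv ?_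
    ext v <;> simp
  have f2 : fderiv ℝ (fderiv ℝ (qtest c a l S)) a = (1 / 2 : ℝ) • (S + S.flip) := by
    have : fderiv ℝ (qtest c a l S) = fun y => l + (1 / 2 : ℝ) • (S (y - a) + S.flip (y - a)) :=
      funext f1
    rw [this]
    refine HasFDerivAt.fderiv ?_
    have h0 : HasFDerivAt (fun z => z - a) (ContinuousLinearMap.id ℝ _) a :=
      (hasFDerivAt_id a).sub_const a
    have h1 := S.hasFDerivAt.comp a h0
    have h2 := S.flip.hasFDerivAt.comp a h0
    have h3 := ((h1.add h2).const_smul (1 / 2 : ℝ)).const_add l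
    exact h3
  rw [f1, f2]
  congr 1
  · simp
  · congr 1
    refine Finset.sum_congr rfl fun r _ => ?_
    simp only [ContinuousLinearMap.smul_apply, ContinuousLinearMap.add_apply,
      ContinuousLinearMap.flip_apply, smul_eq_mul]
    ring
end
end SwitchingPDE
end
end

section
open Set Filter Topology

noncomputable section
namespace SwitchingPDE
section
variable {k d m : ℕ}

theorem col_continuousOn {T : ℝ} {σ : ℝ → EuclideanSpace ℝ (Fin k) → Fin k → Fin d → ℝ}
    (h : ∀ p r, ContinuousOn
      (fun q : ℝ × EuclideanSpace ℝ (Fin k) => σ q.1 q.2 p r) (Icc 0 T ×ˢ univ)) (r : Fin d) :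
    ContinuousOn (col σ r) (Icc 0 T ×ˢ univ) := by
  unfold col
  exact (PiLp.continuous_toLp 2 _).comp_continuousOn (continuousOn_pi.mpr fun p => h p r)

theorem norm_toLp_le (f : Fin k → ℝ) : ‖(WithLp.toLp 2 f : EuclideanSpace ℝ (Fin k))‖ ≤ ∑ p, |f p| := by
  rw [EuclideanSpace.norm_eq]
  refine Real.sqrt_le_iff.mpr ⟨Finset.sum_nonneg fun _ _ => abs_nonneg _, ?_⟩
  simp only [Real.norm_eq_abs]
  exact Finset.sum_sq_le_sq_sum_of_nonneg fun _ _ => abs_nonneg _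

theorem lip_split {T : ℝ} {σ : ℝ → EuclideanSpace ℝ (Fin k) → Fin k → Fin d → ℝ}
    {b : ℝ → EuclideanSpace ℝ (Fin k) → EuclideanSpace ℝ (Fin k)}
    (h : ∃ C : ℝ, ∀ t ∈ Icc (0 : ℝ) T, ∀ x x' : EuclideanSpace ℝ (Fin k),
    (∑ p : Fin k, ∑ r : Fin d, |σ t x p r - σ t x' p r|) + ‖b t x - b t x'‖ ≤ C * ‖x - x'‖) :
    ∃ C : ℝ, 0 ≤ C ∧ ∀ t ∈ Icc (0 : ℝ) T, ∀ x x' : EuclideanSpace ℝ (Fin k),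
      ‖b t x - b t x'‖ ≤ C * ‖x - x'‖ ∧
      ∀ r, ‖col σ r (t, x) - col σ r (t, x')‖ ≤ C * ‖x - x'‖ := by
  obtain ⟨C, hC⟩ := h
  refine ⟨|C|, abs_nonneg C, fun t ht x x' => ?_⟩
  have h1 := hC t ht x x'
  have h2 : C * ‖x - x'‖ ≤ |C| * ‖x - x'‖ :=
    mul_le_mul_of_nonneg_right (le_abs_self C) (norm_nonneg _)
  have h3 : 0 ≤ ∑ p : Fin k, ∑ r : Fin d, |σ t x p r - σ t x' p r| :=
    Finset.sum_nonneg fun _ _ => Finset.sum_nonneg fun _ _ => abs_nonneg _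
  refine ⟨by linarith, fun r => ?_⟩
  have h4 : col σ r (t, x) - col σ r (t, x') =
      WithLp.toLp 2 (fun p => σ t x p r - σ t x' p r) := rfl
  rw [h4]
  refine (norm_toLp_le _).trans ?_
  have h5 : ∑ p, |σ t x p r - σ t x' p r| ≤ ∑ p : Fin k, ∑ r : Fin d, |σ t x p r - σ t x' p r| :=
    Finset.sum_le_sum fun p _ => Finset.single_le_sum
      (f := fun r => |σ t x p r - σ t x' p r|) (fun _ _ => abs_nonneg _) (Finset.mem_univ r)
  have hnn := norm_nonneg (b t x - b t x')
  linarith [hnn]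

/-- squared distance function -/
def sqd (zb z : ℝ × EuclideanSpace ℝ (Fin k)) : ℝ := (z.1 - zb.1) ^ 2 + ‖z.2 - zb.2‖ ^ 2

theorem sqd_contDiff (zb : ℝ × EuclideanSpace ℝ (Fin k)) : ContDiff ℝ 2 (sqd zb) := by
  unfold sqd
  exact ((contDiff_fst.sub contDiff_const).pow 2).add ((contDiff_snd.sub contDiff_const).norm_sq ℝ)

theorem sqd_self (zb : ℝ × EuclideanSpace ℝ (Fin k)) : sqd zb zb = 0 := by simp [sqd]

theorem sqd_ge (zb z : ℝ × EuclideanSpace ℝ (Fin k)) : ‖z - zb‖ ^ 2 ≤ sqd zb z := by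
  unfold sqd
  rw [Prod.norm_def]
  simp only [Prod.fst_sub, Prod.snd_sub]
  rcases max_cases ‖z.1 - zb.1‖ ‖z.2 - zb.2‖ with h | h
  · rw [h.1, Real.norm_eq_abs, sq_abs]; nlinarith [sq_nonneg ‖z.2 - zb.2‖]
  · rw [h.1]; nlinarith [sq_nonneg (z.1 - zb.1)]

theorem local_comparison {T : ℝ} (σ : ℝ → EuclideanSpace ℝ (Fin k) → Fin k → Fin d → ℝ)
    (b : ℝ → EuclideanSpace ℝ (Fin k) → EuclideanSpace ℝ (Fin k))
    (hσ : ∀ r, ContinuousOn (col σ r) (Icc 0 T ×ˢ univ))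
    (hb : ContinuousOn (fun z : ℝ × EuclideanSpace ℝ (Fin k) => b z.1 z.2) (Icc 0 T ×ˢ univ))
    (hlip : ∃ C : ℝ, 0 ≤ C ∧ ∀ t ∈ Icc (0 : ℝ) T, ∀ x x' : EuclideanSpace ℝ (Fin k),
      ‖b t x - b t x'‖ ≤ C * ‖x - x'‖ ∧
      ∀ r, ‖col σ r (t, x) - col σ r (t, x')‖ ≤ C * ‖x - x'‖)
    (f u v P : ℝ × EuclideanSpace ℝ (Fin k) → ℝ)
    (cf : ContinuousOn f (Icc 0 T ×ˢ univ)) (cu : ContinuousOn u (Icc 0 T ×ˢ univ))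
    (cv : ContinuousOn v (Icc 0 T ×ˢ univ)) (hP : ContDiff ℝ 2 P)
    (zb : ℝ × EuclideanSpace ℝ (Fin k)) (hzb : zb.1 ∈ Ioo 0 T)
    (hmax : ∀ᶠ z in 𝓝 zb, u z - v z - P z ≤ u zb - v zb - P zb)
    (hsub : ∀ᶠ z in 𝓝 zb, ∀ φ, ContDiff ℝ 2 φ → φ z = u z → (∀ᶠ y in 𝓝 z, u y ≤ φ y) →
      -Lop σ b φ z - f z ≤ 0)
    (hsup : ∀ᶠ z in 𝓝 zb, ∀ φ, ContDiff ℝ 2 φ → φ z = v z → (∀ᶠ y in 𝓝 z, φ y ≤ v y) →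
      0 ≤ -Lop σ b φ z - f z) : 0 ≤ Lop σ b P zb := by
  by_contra hneg
  have hneg : Lop σ b P zb < 0 := not_le.mp hneg
  set A := |Lop σ b (sqd zb) zb| + 1 with hA
  have hAp : 0 < A := by positivity
  set κ := -Lop σ b P zb / (2 * A) with hκ
  have hκp : 0 < κ := div_pos (by linarith) (by positivity)
  let Pt : ℝ × EuclideanSpace ℝ (Fin k) → ℝ := fun z => P z + κ * sqd zb z
  have hPt : ContDiff ℝ 2 Pt := hP.add (contDiff_const.mul (sqd_contDiff zb))
  have hLPt : Lop σ b Pt zb < 0 := by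
    have h1 : Lop σ b Pt zb = Lop σ b P zb + κ * Lop σ b (sqd zb) zb := by
      rw [Lop_add σ b P _ hP (contDiff_const.mul (sqd_contDiff zb)),
        Lop_const_mul σ b _ (sqd_contDiff zb)]
    have h2 : κ * (2 * A) = -Lop σ b P zb := by rw [hκ]; field_simp
    have h3 : Lop σ b (sqd zb) zb ≤ A := by rw [hA]; linarith [le_abs_self (Lop σ b (sqd zb) zb)]
    have h4 := mul_le_mul_of_nonneg_left h3 hκp.le
    rw [h1]
    linarith
  set c0 := -Lop σ b Pt zb / 2 with hc0
  have hc0p : 0 < c0 := by rw [hc0]; linarith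
  have hOm : Ioo 0 T ×ˢ univ ∈ 𝓝 zb :=
    (isOpen_Ioo.prod isOpen_univ).mem_nhds ⟨hzb, mem_univ _⟩
  have hsubset : (Ioo 0 T ×ˢ univ : Set (ℝ × EuclideanSpace ℝ (Fin k))) ⊆ Icc 0 T ×ˢ univ :=
    prod_mono Ioo_subset_Icc_self Subset.rfl
  have hcont := (Lop_continuousOn σ b _ hσ hb Pt hPt).continuousAt (mem_of_superset hOm hsubset)
  have hev : ∀ᶠ z in 𝓝 zb, Lop σ b Pt z < -c0 :=
    hcont.eventually_lt_const (by rw [hc0]; linarith)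
  obtain ⟨r, hr, hrK⟩ := Metric.nhds_basis_closedBall.eventually_iff.mp
    (hOm |> fun h => ((eventually_mem_set.mpr h).and hev).and (hmax.and (hsub.and hsup)))
  have hKs : Metric.closedBall zb r ⊆ Icc 0 T ×ˢ univ := fun z hz => hsubset (hrK hz).1.1
  obtain ⟨C, hC, hlip⟩ := hlip
  have T0 : ∀ a : ℝ × EuclideanSpace ℝ (Fin k), Tendsto (fun y => y - a) (𝓝 a) (𝓝 0) := by
    intro a
    have h : Tendsto (fun y => y - a) (𝓝 a) (𝓝 (a - a)) :=
      (continuous_id.sub continuous_const).tendsto a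
    rwa [sub_self] at h
  refine no_max zb r hr (fun z => u z - Pt z) v ((cu.mono hKs).sub hPt.continuous.continuousOn)
    (cv.mono hKs) κ hκp ?_ (fun z => b z.1 z.2) (col σ) f c0 hc0p (hb.mono hKs)
    (fun i => (hσ i).mono hKs) (cf.mono hKs) C hC ?_ ?_ ?_ ?_
  · intro z hz
    have h1 := (hrK hz).2.1
    have h2 := mul_le_mul_of_nonneg_left (sqd_ge zb z) hκp.le
    simp only [Pt, sqd_self]
    linarith
  · exact fun t x x' h h' => (hlip t (hKs h).1 x x').1
  · exact fun i t x x' h h' => (hlip t (hKs h).1 x x').2 i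
  · intro a ha l S hlS
    have h1 := (hrK ha).2.2.1 (fun z => Pt z + qtest (u a - Pt a) a l S z)
      (hPt.add (qtest_contDiff _ _ _ _)) (by simp [qtest]) (by
        filter_upwards [(T0 a).eventually hlS] with y hy
        simp only [add_sub_cancel] at hy
        simp only [qtest]
        linarith)
    rw [Lop_add σ b _ _ hPt (qtest_contDiff _ _ _ _), Lop_qtest] at h1
    have h2 := (hrK ha).1.2
    linarith
  · intro a ha l S hlS
    have h1 := (hrK ha).2.2.2 (qtest (v a) a l S)
      (qtest_contDiff _ _ _ _) (by simp [qtest]) (by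
        filter_upwards [(T0 a).eventually hlS] with y hy
        simp only [add_sub_cancel] at hy
        simp only [qtest]
        linarith)
    rw [Lop_qtest] at h1
    linarith
end
end SwitchingPDE
end
end

section
open Set Filter Topology

noncomputable section
namespace SwitchingPDE
section
variable {k d m : ℕ}

theorem Lop_mul (σ : ℝ → EuclideanSpace ℝ (Fin k) → Fin k → Fin d → ℝ)
    (b : ℝ → EuclideanSpace ℝ (Fin k) → EuclideanSpace ℝ (Fin k))
    (φ χ : ℝ × EuclideanSpace ℝ (Fin k) → ℝ) (hφ : ContDiff ℝ 2 φ) (hχ : ContDiff ℝ 2 χ)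
    (z : ℝ × EuclideanSpace ℝ (Fin k)) :
    Lop σ b (fun y => φ y * χ y) z = φ z * Lop σ b χ z + χ z * Lop σ b φ z
      + ∑ r, fderiv ℝ φ z (0, col σ r z) * fderiv ℝ χ z (0, col σ r z) := by
  have d1 : Differentiable ℝ φ := hφ.differentiable (by norm_num)
  have d2 : Differentiable ℝ χ := hχ.differentiable (by norm_num)
  have e1 : Differentiable ℝ (fderiv ℝ φ) :=
    (hφ.fderiv_right (m := 1) (by norm_num)).differentiable (by norm_num)
  have e2 : Differentiable ℝ (fderiv ℝ χ) :=
    (hχ.fderiv_right (m := 1) (by norm_num)).differentiable (by norm_num)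
  rw [Lop_eq σ b _ (hφ.mul hχ), Lop_eq σ b _ hφ, Lop_eq σ b _ hχ]
  have f1 : fderiv ℝ (fun y => φ y * χ y) = fun y => φ y • fderiv ℝ χ y + χ y • fderiv ℝ φ y := by
    funext y
    exact fderiv_fun_mul (d1 y) (d2 y)
  have f2 : ∀ h, fderiv ℝ (fderiv ℝ (fun y => φ y * χ y)) z h h =
      φ z * fderiv ℝ (fderiv ℝ χ) z h h + χ z * fderiv ℝ (fderiv ℝ φ) z h h
      + 2 * (fderiv ℝ φ z h * fderiv ℝ χ z h) := by
    intro h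
    rw [f1]
    have h1 := ((d1 z).hasFDerivAt.smul (e2 z).hasFDerivAt).add
      ((d2 z).hasFDerivAt.smul (e1 z).hasFDerivAt)
    have h2 := h1.fderiv
    have h3 : fderiv ℝ (fun y => φ y • fderiv ℝ χ y + χ y • fderiv ℝ φ y) z = _ := h2
    rw [h3]
    simp
    ring
  simp only [f2]
  rw [f1]
  simp only [ContinuousLinearMap.add_apply, ContinuousLinearMap.smul_apply, smul_eq_mul,
    Finset.sum_add_distrib, ← Finset.mul_sum]
  ring

theorem fderiv_qtest_self (c : ℝ) (a : ℝ × EuclideanSpace ℝ (Fin k))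
    (l : ℝ × EuclideanSpace ℝ (Fin k) →L[ℝ] ℝ)
    (S : (ℝ × EuclideanSpace ℝ (Fin k)) →L[ℝ] (ℝ × EuclideanSpace ℝ (Fin k)) →L[ℝ] ℝ) :
    fderiv ℝ (qtest c a l S) a = l := by
  refine HasFDerivAt.fderiv ?_
  have h0 : HasFDerivAt (fun z => z - a) (ContinuousLinearMap.id ℝ _) a :=
    (hasFDerivAt_id a).sub_const a
  have h1 := l.hasFDerivAt.comp a h0
  have h2 := (S.hasFDerivAt.comp a h0).clm_apply h0
  have h3 := ((hasFDerivAt_const c a).add h1).add (h2.const_mul (1 / 2))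
  refine h3.congr_fderiv ?_
  ext v <;> simp

/-- the weight `1 + |x|²` -/
def wY (z : ℝ × EuclideanSpace ℝ (Fin k)) : ℝ := 1 + ‖z.2‖ ^ 2

theorem wY_eq (a : ℝ × EuclideanSpace ℝ (Fin k)) :
    (wY : ℝ × EuclideanSpace ℝ (Fin k) → ℝ) = qtest (1 + ‖a.2‖ ^ 2) a
      ((2:ℝ) • (innerB (EuclideanSpace ℝ (Fin k)) a.2).comp
        (ContinuousLinearMap.snd ℝ ℝ (EuclideanSpace ℝ (Fin k))))
      ((2:ℝ) • (innerB (EuclideanSpace ℝ (Fin k))).bilinearComp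
        (ContinuousLinearMap.snd ℝ ℝ (EuclideanSpace ℝ (Fin k)))
        (ContinuousLinearMap.snd ℝ ℝ (EuclideanSpace ℝ (Fin k)))) := by
  funext z
  change 1 + ‖z.2‖ ^ 2 = 1 + ‖a.2‖ ^ 2 + 2 * inner ℝ a.2 (z.2 - a.2)
    + 1 / 2 * (2 * inner ℝ (z.2 - a.2) (z.2 - a.2))
  have : z.2 = a.2 + (z.2 - a.2) := by abel
  rw [real_inner_self_eq_norm_sq]
  conv_lhs => rw [this, norm_add_sq_real]
  ring

theorem wY_contDiff : ContDiff ℝ 2 (wY : ℝ × EuclideanSpace ℝ (Fin k) → ℝ) := by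
  rw [wY_eq 0]; exact qtest_contDiff _ _ _ _

theorem wY_one_le (z : ℝ × EuclideanSpace ℝ (Fin k)) : 1 ≤ wY z := by
  unfold wY; nlinarith [sq_nonneg ‖z.2‖]

theorem Lop_wY (σ : ℝ → EuclideanSpace ℝ (Fin k) → Fin k → Fin d → ℝ)
    (b : ℝ → EuclideanSpace ℝ (Fin k) → EuclideanSpace ℝ (Fin k))
    (a : ℝ × EuclideanSpace ℝ (Fin k)) :
    Lop σ b wY a = 2 * inner ℝ a.2 (b a.1 a.2) + 1 / 2 * ∑ r, 2 * ‖col σ r a‖ ^ 2 := by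
  rw [wY_eq a, Lop_qtest]
  change 2 * inner ℝ a.2 (b a.1 a.2) + 1 / 2 * ∑ r, 2 * inner ℝ (col σ r a) (col σ r a) = _
  simp only [real_inner_self_eq_norm_sq]

theorem fderiv_wY (a h : ℝ × EuclideanSpace ℝ (Fin k)) :
    fderiv ℝ wY a h = 2 * inner ℝ a.2 h.2 := by
  rw [wY_eq a, fderiv_qtest_self]
  rfl

/-- functions controlled by the operator -/
def Ctrl (T : ℝ) (σ : ℝ → EuclideanSpace ℝ (Fin k) → Fin k → Fin d → ℝ)
    (b : ℝ → EuclideanSpace ℝ (Fin k) → EuclideanSpace ℝ (Fin k))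
    (φ : ℝ × EuclideanSpace ℝ (Fin k) → ℝ) (C : ℝ) : Prop :=
  ContDiff ℝ 2 φ ∧ 0 ≤ C ∧ (∀ z, 0 ≤ φ z) ∧ ∀ z, z.1 ∈ Icc 0 T →
    |Lop σ b φ z| ≤ C * φ z ∧ ∀ r, |fderiv ℝ φ z (0, col σ r z)| ≤ C * φ z

theorem Ctrl.mul {T : ℝ} {σ : ℝ → EuclideanSpace ℝ (Fin k) → Fin k → Fin d → ℝ}
    {b : ℝ → EuclideanSpace ℝ (Fin k) → EuclideanSpace ℝ (Fin k)}
    {φ χ : ℝ × EuclideanSpace ℝ (Fin k) → ℝ} {C D : ℝ} (hφ : Ctrl T σ b φ C)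
    (hχ : Ctrl T σ b χ D) : Ctrl T σ b (fun z => φ z * χ z) (C + D + d * (C * D)) := by
  obtain ⟨c1, p1, n1, q1⟩ := hφ
  obtain ⟨c2, p2, n2, q2⟩ := hχ
  have hdC : 0 ≤ (d:ℝ) * (C * D) := by positivity
  refine ⟨c1.mul c2, by positivity, fun z => mul_nonneg (n1 z) (n2 z), fun z hz => ⟨?_, ?_⟩⟩
  · rw [Lop_mul σ b φ χ c1 c2]
    have a1 : |φ z * Lop σ b χ z| ≤ φ z * (D * χ z) := by
      rw [abs_mul, abs_of_nonneg (n1 z)]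
      exact mul_le_mul_of_nonneg_left (q2 z hz).1 (n1 z)
    have a2 : |χ z * Lop σ b φ z| ≤ χ z * (C * φ z) := by
      rw [abs_mul, abs_of_nonneg (n2 z)]
      exact mul_le_mul_of_nonneg_left (q1 z hz).1 (n2 z)
    have a3 : |∑ r, fderiv ℝ φ z (0, col σ r z) * fderiv ℝ χ z (0, col σ r z)| ≤
        d * ((C * φ z) * (D * χ z)) := by
      refine (Finset.abs_sum_le_sum_abs _ _).trans ?_
      have : ∀ r ∈ Finset.univ, |fderiv ℝ φ z (0, col σ r z) * fderiv ℝ χ z (0, col σ r z)| ≤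
          (C * φ z) * (D * χ z) := by
        intro r _
        rw [abs_mul]
        exact mul_le_mul ((q1 z hz).2 r) ((q2 z hz).2 r) (abs_nonneg _) (mul_nonneg p1 (n1 z))
      simpa using Finset.sum_le_card_nsmul _ _ _ this
    refine (abs_add_le _ _).trans ((add_le_add (abs_add_le _ _) le_rfl).trans ?_)
    linarith
  · intro r
    have d1 : Differentiable ℝ φ := c1.differentiable (by norm_num)
    have d2 : Differentiable ℝ χ := c2.differentiable (by norm_num)
    rw [fderiv_fun_mul (d1 z) (d2 z)]
    simp only [ContinuousLinearMap.add_apply, ContinuousLinearMap.smul_apply, smul_eq_mul]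
    have a1 : |φ z * fderiv ℝ χ z (0, col σ r z)| ≤ φ z * (D * χ z) := by
      rw [abs_mul, abs_of_nonneg (n1 z)]
      exact mul_le_mul_of_nonneg_left ((q2 z hz).2 r) (n1 z)
    have a2 : |χ z * fderiv ℝ φ z (0, col σ r z)| ≤ χ z * (C * φ z) := by
      rw [abs_mul, abs_of_nonneg (n2 z)]
      exact mul_le_mul_of_nonneg_left ((q1 z hz).2 r) (n2 z)
    refine (abs_add_le _ _).trans ?_
    have := mul_nonneg hdC (mul_nonneg (n1 z) (n2 z))
    linarith

theorem linear_growth {T : ℝ} (hT : 0 < T) {G : Type*} [NormedAddCommGroup G]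
    (c : ℝ → EuclideanSpace ℝ (Fin k) → G)
    (hc : ContinuousOn (fun z : ℝ × EuclideanSpace ℝ (Fin k) => c z.1 z.2) (Icc 0 T ×ˢ univ))
    (C : ℝ) (hC : 0 ≤ C) (hl : ∀ t ∈ Icc 0 T, ∀ x, ‖c t x - c t 0‖ ≤ C * ‖x - 0‖) :
    ∃ K, 0 ≤ K ∧ ∀ t ∈ Icc 0 T, ∀ x, ‖c t x‖ ≤ K * (1 + ‖x‖) := by
  have h1 : ContinuousOn (fun t => c t 0) (Icc 0 T) :=
    hc.comp (f := fun t : ℝ => (t, (0 : EuclideanSpace ℝ (Fin k)))) (by fun_prop)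
      (fun t ht => ⟨ht, mem_univ _⟩)
  obtain ⟨M, hM⟩ := isCompact_Icc.exists_bound_of_continuousOn h1
  have hM0 : 0 ≤ M := (norm_nonneg _).trans (hM 0 ⟨le_rfl, hT.le⟩)
  refine ⟨M + C, by positivity, fun t ht x => ?_⟩
  have h2 := hl t ht x
  rw [sub_zero] at h2
  have h3 := hM t ht
  have h4 := norm_le_norm_add_norm_sub' (c t x) (c t 0)
  nlinarith [norm_nonneg x, mul_nonneg hM0 (norm_nonneg x)]

theorem Ctrl_wY {T : ℝ} (hT : 0 < T) {σ : ℝ → EuclideanSpace ℝ (Fin k) → Fin k → Fin d → ℝ}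
    {b : ℝ → EuclideanSpace ℝ (Fin k) → EuclideanSpace ℝ (Fin k)}
    (hσ : ∀ r, ContinuousOn (col σ r) (Icc 0 T ×ˢ univ))
    (hb : ContinuousOn (fun z : ℝ × EuclideanSpace ℝ (Fin k) => b z.1 z.2) (Icc 0 T ×ˢ univ))
    (hlip : ∃ C : ℝ, 0 ≤ C ∧ ∀ t ∈ Icc (0 : ℝ) T, ∀ x x' : EuclideanSpace ℝ (Fin k),
      ‖b t x - b t x'‖ ≤ C * ‖x - x'‖ ∧
      ∀ r, ‖col σ r (t, x) - col σ r (t, x')‖ ≤ C * ‖x - x'‖) : ∃ C, Ctrl T σ b wY C := by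
  obtain ⟨C, hC, hl⟩ := hlip
  obtain ⟨Kb, hKb, gb⟩ := linear_growth hT b hb C hC (fun t ht x => (hl t ht x 0).1)
  choose Ks hKs gs using fun r => linear_growth hT (fun t x => col σ r (t, x)) (hσ r) C hC
    (fun t ht x => (hl t ht x 0).2 r)
  have hsum : 0 ≤ ∑ r, Ks r := Finset.sum_nonneg fun r _ => hKs r
  set K := Kb + ∑ r, Ks r with hK
  have hKp : 0 ≤ K := by positivity
  have hsr : ∀ r, Ks r ≤ K := fun r => by
    have := Finset.single_le_sum (f := Ks) (fun r _ => hKs r) (Finset.mem_univ r)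
    linarith
  have aux : ∀ s : ℝ, 0 ≤ s → s * (1 + s) ≤ 2 * (1 + s ^ 2) := fun s hs => by
    nlinarith [sq_nonneg (s - 1)]
  have aux2 : ∀ s : ℝ, 0 ≤ s → (1 + s) ^ 2 ≤ 2 * (1 + s ^ 2) := fun s hs => by
    nlinarith [sq_nonneg (s - 1)]
  have hin : ∀ (x y : EuclideanSpace ℝ (Fin k)), ‖y‖ ≤ K * (1 + ‖x‖) →
      |2 * inner ℝ x y| ≤ 4 * K * (1 + ‖x‖ ^ 2) := by
    intro x y hy
    rw [abs_mul, abs_two]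
    have h1 := abs_real_inner_le_norm x y
    have h2 := mul_le_mul_of_nonneg_left hy (norm_nonneg x)
    have h3 := mul_le_mul_of_nonneg_left (aux ‖x‖ (norm_nonneg x)) hKp
    linarith
  refine ⟨4 * K + d * (2 * K ^ 2), wY_contDiff, by positivity,
    fun z => zero_le_one.trans (wY_one_le z), fun z hz => ⟨?_, ?_⟩⟩
  · rw [Lop_wY]
    have h1 := hin z.2 (b z.1 z.2) ((gb z.1 hz z.2).trans
      (mul_le_mul_of_nonneg_right (by linarith) (by positivity)))
    have h2 : ∑ r, 2 * ‖col σ r z‖ ^ 2 ≤ d * (4 * K ^ 2 * (1 + ‖z.2‖ ^ 2)) := by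
      have : ∀ r ∈ Finset.univ, 2 * ‖col σ r z‖ ^ 2 ≤ 4 * K ^ 2 * (1 + ‖z.2‖ ^ 2) := by
        intro r _
        have h3 : ‖col σ r z‖ ≤ K * (1 + ‖z.2‖) := (gs r z.1 hz z.2).trans
          (mul_le_mul_of_nonneg_right (hsr r) (by positivity))
        have h4 := pow_le_pow_left₀ (norm_nonneg _) h3 2
        have h5 := mul_le_mul_of_nonneg_left (aux2 ‖z.2‖ (norm_nonneg _)) (sq_nonneg K)
        rw [mul_pow] at h4
        linarith
      simpa using Finset.sum_le_card_nsmul _ _ _ this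
    have h3 : 0 ≤ ∑ r, 2 * ‖col σ r z‖ ^ 2 := Finset.sum_nonneg fun r _ => by positivity
    refine (abs_add_le _ _).trans ?_
    rw [abs_of_nonneg (mul_nonneg (by norm_num) h3)]
    unfold wY
    linarith
  · intro r
    rw [fderiv_wY]
    have h1 := hin z.2 (col σ r z) ((gs r z.1 hz z.2).trans
      (mul_le_mul_of_nonneg_right (hsr r) (by positivity)))
    have : 0 ≤ d * (2 * K ^ 2) * (1 + ‖z.2‖ ^ 2) := by positivity
    unfold wY
    simp only at h1 ⊢
    linarith

theorem Ctrl_pow {T : ℝ} {σ : ℝ → EuclideanSpace ℝ (Fin k) → Fin k → Fin d → ℝ}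
    {b : ℝ → EuclideanSpace ℝ (Fin k) → EuclideanSpace ℝ (Fin k)}
    {φ : ℝ × EuclideanSpace ℝ (Fin k) → ℝ} {C : ℝ} (h : Ctrl T σ b φ C) (n : ℕ) :
    ∃ D, Ctrl T σ b (fun z => φ z ^ (n + 1)) D := by
  induction n with
  | zero => exact ⟨C, by simpa using h⟩
  | succ n ih =>
    obtain ⟨D, hD⟩ := ih
    refine ⟨D + C + d * (D * C), ?_⟩
    have h2 := hD.mul h
    have h3 : (fun z => φ z ^ (n + 1 + 1)) = fun z => φ z ^ (n + 1) * φ z :=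
      funext fun z => pow_succ _ _
    rw [h3]
    exact h2

/-- time exponential -/
def tE (Λ : ℝ) (z : ℝ × EuclideanSpace ℝ (Fin k)) : ℝ := Real.exp (-Λ * z.1)

theorem tE_contDiff (Λ : ℝ) : ContDiff ℝ 2 (tE Λ : ℝ × EuclideanSpace ℝ (Fin k) → ℝ) := by
  unfold tE
  exact (contDiff_const.mul contDiff_fst).exp

theorem fderiv_tE (Λ : ℝ) : fderiv ℝ (tE Λ : ℝ × EuclideanSpace ℝ (Fin k) → ℝ) =
    fun z => (-Λ * tE Λ z) • ContinuousLinearMap.fst ℝ ℝ (EuclideanSpace ℝ (Fin k)) := by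
  funext z
  refine HasFDerivAt.fderiv ?_
  have h := ((hasFDerivAt_fst (𝕜 := ℝ) (p := z)).const_mul (-Λ)).exp
  refine h.congr_fderiv ?_
  rw [smul_smul, mul_comm]
  rfl

theorem Lop_tE (σ : ℝ → EuclideanSpace ℝ (Fin k) → Fin k → Fin d → ℝ)
    (b : ℝ → EuclideanSpace ℝ (Fin k) → EuclideanSpace ℝ (Fin k)) (Λ : ℝ)
    (z : ℝ × EuclideanSpace ℝ (Fin k)) : Lop σ b (tE Λ) z = -Λ * tE Λ z := by
  rw [Lop_eq σ b _ (tE_contDiff Λ)]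
  have h2 : ∀ h : EuclideanSpace ℝ (Fin k),
      fderiv ℝ (fderiv ℝ (tE Λ : ℝ × EuclideanSpace ℝ (Fin k) → ℝ)) z (0, h) (0, h) = 0 := by
    intro h
    rw [fderiv_tE]
    have d1 : DifferentiableAt ℝ (fun z : ℝ × EuclideanSpace ℝ (Fin k) => -Λ * tE Λ z) z :=
      (contDiff_const.mul (tE_contDiff Λ)).contDiffAt.differentiableAt (by norm_num)
    have h3 := (d1.hasFDerivAt.smul
      (hasFDerivAt_const (ContinuousLinearMap.fst ℝ ℝ (EuclideanSpace ℝ (Fin k))) z)).fderiv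
    have h4 : fderiv ℝ (fun z : ℝ × EuclideanSpace ℝ (Fin k) => (-Λ * tE Λ z) •
      ContinuousLinearMap.fst ℝ ℝ (EuclideanSpace ℝ (Fin k))) z = _ := h3
    rw [h4]
    simp
  simp only [h2]
  rw [fderiv_tE]
  simp

theorem Lop_weight {T : ℝ} {σ : ℝ → EuclideanSpace ℝ (Fin k) → Fin k → Fin d → ℝ}
    {b : ℝ → EuclideanSpace ℝ (Fin k) → EuclideanSpace ℝ (Fin k)}
    {φ : ℝ × EuclideanSpace ℝ (Fin k) → ℝ} {C : ℝ} (h : Ctrl T σ b φ C)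
    (z : ℝ × EuclideanSpace ℝ (Fin k)) (hz : z.1 ∈ Icc 0 T) :
    Lop σ b (fun y => tE C y * φ y) z ≤ 0 := by
  obtain ⟨c1, p1, n1, q1⟩ := h
  rw [Lop_mul σ b _ _ (tE_contDiff C) c1, Lop_tE, fderiv_tE]
  have h1 : 0 ≤ tE C z := (Real.exp_pos _).le
  have h2 := mul_le_mul_of_nonneg_left ((le_abs_self _).trans (q1 z hz).1) h1
  simp only [ContinuousLinearMap.smul_apply, ContinuousLinearMap.coe_fst', smul_zero, zero_mul,
    Finset.sum_const_zero]
  linarith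
end
end SwitchingPDE
end
end

section
open Set Filter Topology

noncomputable section
namespace SwitchingPDE
section
variable {k d m : ℕ}

theorem le_maxNe (i j : Fin m) (hj : j ≠ i) (f : Fin m → ℝ) : f j ≤ maxNe i f :=
  le_ciSup (f := fun j : {j : Fin m // j ≠ i} => f j) (Set.finite_range _).bddAbove ⟨j, hj⟩

theorem maxNe_lt (hm : 2 ≤ m) (i : Fin m) (f : Fin m → ℝ) (c : ℝ) (h : ∀ j, j ≠ i → f j < c) :
    maxNe i f < c := by
  have : Nontrivial (Fin m) := Fin.nontrivial_iff_two_le.mpr hm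
  obtain ⟨j0, hj0⟩ := exists_ne i
  have : Nonempty {j : Fin m // j ≠ i} := ⟨⟨j0, hj0⟩⟩
  obtain ⟨j, hj⟩ := exists_eq_ciSup_of_finite (f := fun j : {j : Fin m // j ≠ i} => f j)
  unfold maxNe
  rw [← hj]
  exact h j j.2

theorem super_pde {T : ℝ} {σ : ℝ → EuclideanSpace ℝ (Fin k) → Fin k → Fin d → ℝ}
    {b : ℝ → EuclideanSpace ℝ (Fin k) → EuclideanSpace ℝ (Fin k)}
    {ψ : Fin m → ℝ → EuclideanSpace ℝ (Fin k) → ℝ}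
    {g : Fin m → Fin m → ℝ → EuclideanSpace ℝ (Fin k) → ℝ}
    {v : Fin m → ℝ → EuclideanSpace ℝ (Fin k) → ℝ}
    (h : IsViscositySupersolution T σ b ψ g v) (i : Fin m) (z : ℝ × EuclideanSpace ℝ (Fin k))
    (hz : z.1 ∈ Ioo 0 T) (φ : ℝ × EuclideanSpace ℝ (Fin k) → ℝ) (hφ : ContDiff ℝ 2 φ)
    (he : φ z = v i z.1 z.2) (hle : ∀ᶠ y in 𝓝 z, φ y ≤ v i y.1 y.2) :
    (∀ j, j ≠ i → v j z.1 z.2 - g i j z.1 z.2 ≤ v i z.1 z.2) ∧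
      0 ≤ -Lop σ b φ z - ψ i z.1 z.2 := by
  have h1 := h i z.1 ⟨hz.1.le, hz.2⟩ z.2 φ hφ he (by
    refine Filter.Eventually.filter_mono nhdsWithin_le_nhds ?_
    filter_upwards [hle] with y hy
    simp only [Prod.mk.eta, he, sub_self]
    linarith)
  rw [le_min_iff] at h1
  refine ⟨fun j hj => ?_, ?_⟩
  · have := le_maxNe i j hj (fun j => -(g i j z.1 z.2) + v j z.1 z.2)
    linarith [h1.1]
  · unfold Lop
    linarith [h1.2]

theorem sub_pde (hm : 2 ≤ m) {T : ℝ} {σ : ℝ → EuclideanSpace ℝ (Fin k) → Fin k → Fin d → ℝ}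
    {b : ℝ → EuclideanSpace ℝ (Fin k) → EuclideanSpace ℝ (Fin k)}
    {ψ : Fin m → ℝ → EuclideanSpace ℝ (Fin k) → ℝ}
    {g : Fin m → Fin m → ℝ → EuclideanSpace ℝ (Fin k) → ℝ}
    {v : Fin m → ℝ → EuclideanSpace ℝ (Fin k) → ℝ}
    (h : IsViscositySubsolution T σ b ψ g v) (i : Fin m) (z : ℝ × EuclideanSpace ℝ (Fin k))
    (hz : z.1 ∈ Ioo 0 T) (φ : ℝ × EuclideanSpace ℝ (Fin k) → ℝ) (hφ : ContDiff ℝ 2 φ)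
    (he : φ z = v i z.1 z.2) (hle : ∀ᶠ y in 𝓝 z, v i y.1 y.2 ≤ φ y)
    (hlt : ∀ j, j ≠ i → v j z.1 z.2 - g i j z.1 z.2 < v i z.1 z.2) :
    -Lop σ b φ z - ψ i z.1 z.2 ≤ 0 := by
  have h1 := h i z.1 ⟨hz.1.le, hz.2⟩ z.2 φ hφ he (by
    refine Filter.Eventually.filter_mono nhdsWithin_le_nhds ?_
    filter_upwards [hle] with y hy
    simp only [Prod.mk.eta, he, sub_self]
    linarith)
  have h2 := maxNe_lt hm i (fun j => -(g i j z.1 z.2) + v j z.1 z.2) (v i z.1 z.2)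
    (fun j hj => by have := hlt j hj; linarith)
  rcases min_le_iff.mp h1 with h3 | h3
  · linarith
  · unfold Lop
    linarith

theorem obstacle {T : ℝ} {σ : ℝ → EuclideanSpace ℝ (Fin k) → Fin k → Fin d → ℝ}
    {b : ℝ → EuclideanSpace ℝ (Fin k) → EuclideanSpace ℝ (Fin k)}
    {ψ : Fin m → ℝ → EuclideanSpace ℝ (Fin k) → ℝ}
    {g : Fin m → Fin m → ℝ → EuclideanSpace ℝ (Fin k) → ℝ}
    {v : Fin m → ℝ → EuclideanSpace ℝ (Fin k) → ℝ}
    (h : IsViscositySupersolution T σ b ψ g v)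
    (cv : ∀ i, ContinuousOn (fun p : ℝ × EuclideanSpace ℝ (Fin k) => v i p.1 p.2)
      (Icc 0 T ×ˢ univ))
    (cg : ∀ i j, ContinuousOn
      (fun p : ℝ × EuclideanSpace ℝ (Fin k) => g i j p.1 p.2) (Icc 0 T ×ˢ univ))
    (i j : Fin m) (hj : j ≠ i) (zb : ℝ × EuclideanSpace ℝ (Fin k)) (hz : zb.1 ∈ Ioo 0 T) :
    v j zb.1 zb.2 - g i j zb.1 zb.2 ≤ v i zb.1 zb.2 := by
  by_contra hcon
  have hcon : 0 < v j zb.1 zb.2 - g i j zb.1 zb.2 - v i zb.1 zb.2 := by linarith [not_le.mp hcon]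
  have hOm : Ioo 0 T ×ˢ univ ∈ 𝓝 zb :=
    (isOpen_Ioo.prod isOpen_univ).mem_nhds ⟨hz, mem_univ _⟩
  have hsubset : (Ioo 0 T ×ˢ univ : Set (ℝ × EuclideanSpace ℝ (Fin k))) ⊆ Icc 0 T ×ˢ univ :=
    prod_mono Ioo_subset_Icc_self Subset.rfl
  have hc := (((cv j).sub (cg i j)).sub (cv i)).continuousAt (mem_of_superset hOm hsubset)
  have hev : ∀ᶠ z in 𝓝 zb, 0 < v j z.1 z.2 - g i j z.1 z.2 - v i z.1 z.2 :=
    hc.eventually_const_lt hcon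
  obtain ⟨r, hr, hrK⟩ := Metric.nhds_basis_closedBall.eventually_iff.mp
    ((eventually_mem_set.mpr hOm).and hev)
  have hKs : Metric.closedBall zb r ⊆ Icc 0 T ×ˢ univ := fun z hz => hsubset (hrK hz).1
  have hKc : IsCompact (Metric.closedBall zb r) := isCompact_closedBall _ _
  have hzb : zb ∈ Metric.closedBall zb r := Metric.mem_closedBall_self hr.le
  obtain ⟨M, hM⟩ := hKc.exists_bound_of_continuousOn ((cv i).mono hKs)
  have hM0 : 0 ≤ M := (norm_nonneg _).trans (hM zb hzb)
  set n := (2 * M + 1) / r ^ 2 with hn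
  have hnp : 0 < n := by positivity
  have hne : n * r ^ 2 = 2 * M + 1 := by rw [hn]; field_simp
  obtain ⟨z, hzK, hzmin⟩ := hKc.exists_isMinOn ⟨zb, hzb⟩
    (f := fun z => v i z.1 z.2 + n * sqd zb z)
    (((cv i).mono hKs).add (continuousOn_const.mul (sqd_contDiff zb).continuous.continuousOn))
  have h1 : v i z.1 z.2 + n * sqd zb z ≤ v i zb.1 zb.2 + n * sqd zb zb := hzmin hzb
  rw [sqd_self] at h1
  have h2 := abs_le.mp (hM z hzK)
  have h3 := abs_le.mp (hM zb hzb)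
  have h4 : ‖z - zb‖ < r := by
    have h5 := mul_le_mul_of_nonneg_left (sqd_ge zb z) hnp.le
    have : n * ‖z - zb‖ ^ 2 < n * r ^ 2 := by linarith
    exact lt_of_pow_lt_pow_left₀ 2 hr.le (lt_of_mul_lt_mul_left this hnp.le)
  have hKz : Metric.closedBall zb r ∈ 𝓝 z := Metric.closedBall_mem_nhds_of_mem
    (by rw [Metric.mem_ball, dist_eq_norm]; exact h4)
  have h6 := (super_pde h i z (hrK hzK).1.1
    (fun y => (v i z.1 z.2 + n * sqd zb z) + (-n) * sqd zb y)
    (contDiff_const.add (contDiff_const.mul (sqd_contDiff zb))) (by ring) (by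
      filter_upwards [hKz] with y hy
      have : v i z.1 z.2 + n * sqd zb z ≤ v i y.1 y.2 + n * sqd zb y := hzmin hy
      linarith)).1 j hj
  have h7 := (hrK hzK).2
  linarith

theorem growth {T : ℝ} (hT : 0 < T) (v : ℝ → EuclideanSpace ℝ (Fin k) → ℝ) (h : InClassC T v) :
    ∃ C : ℝ, ∃ n : ℕ, 0 ≤ C ∧ ∀ z : ℝ × EuclideanSpace ℝ (Fin k), z.1 ∈ Icc 0 T →
      |v z.1 z.2| ≤ C * wY z ^ n := by
  obtain ⟨hc, C, γ, hb⟩ := h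
  have hKc : IsCompact (Icc 0 T ×ˢ Metric.closedBall (0 : EuclideanSpace ℝ (Fin k)) 1) :=
    isCompact_Icc.prod (isCompact_closedBall _ _)
  obtain ⟨M, hM⟩ := hKc.exists_bound_of_continuousOn
    (hc.mono (prod_mono Subset.rfl (subset_univ _)))
  have hM0 : 0 ≤ M := (norm_nonneg _).trans
    (hM (0, 0) ⟨⟨le_rfl, hT.le⟩, Metric.mem_closedBall_self zero_le_one⟩)
  refine ⟨M + 2 * |C|, ⌈γ⌉₊, by positivity, fun z hz => ?_⟩
  have hY : 1 ≤ wY z ^ ⌈γ⌉₊ := one_le_pow₀ (wY_one_le z)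
  have hCn := abs_nonneg C
  rcases le_total ‖z.2‖ 1 with h1 | h1
  · have := hM z ⟨hz, by simpa using h1⟩
    rw [Real.norm_eq_abs] at this
    nlinarith [mul_nonneg hM0 (sub_nonneg.mpr hY), mul_nonneg hCn (zero_le_one.trans hY)]
  · have h2 := hb z.1 hz z.2
    have h3 : ‖z.2‖ ^ γ ≤ wY z ^ ⌈γ⌉₊ := by
      calc ‖z.2‖ ^ γ ≤ ‖z.2‖ ^ ((⌈γ⌉₊ : ℕ) : ℝ) :=
            Real.rpow_le_rpow_of_exponent_le h1 (Nat.le_ceil γ)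
        _ = ‖z.2‖ ^ ⌈γ⌉₊ := Real.rpow_natCast _ _
        _ ≤ wY z ^ ⌈γ⌉₊ := by
            refine pow_le_pow_left₀ (norm_nonneg _) ?_ _
            unfold wY
            nlinarith [sq_nonneg (‖z.2‖ - 1)]
    have h4 : 0 ≤ 1 + ‖z.2‖ ^ γ := by positivity
    have h5 := mul_le_mul_of_nonneg_right (le_abs_self C) h4
    have h6 : |C| * (1 + ‖z.2‖ ^ γ) ≤ |C| * (2 * wY z ^ ⌈γ⌉₊) :=
      mul_le_mul_of_nonneg_left (by linarith) hCn
    nlinarith [mul_nonneg hM0 (zero_le_one.trans hY)]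

theorem growth_family {T : ℝ} (hT : 0 < T) (v : Fin m → ℝ → EuclideanSpace ℝ (Fin k) → ℝ)
    (h : ∀ i, InClassC T (v i)) :
    ∃ C : ℝ, ∃ n : ℕ, 0 ≤ C ∧ ∀ i, ∀ z : ℝ × EuclideanSpace ℝ (Fin k), z.1 ∈ Icc 0 T →
      |v i z.1 z.2| ≤ C * wY z ^ n := by
  choose C n hC hb using fun i => growth hT (v i) (h i)
  refine ⟨∑ i, C i, ∑ i, n i, Finset.sum_nonneg fun i _ => hC i, fun i z hz => ?_⟩
  refine (hb i z hz).trans ?_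
  have h1 : C i ≤ ∑ i, C i := Finset.single_le_sum (fun i _ => hC i) (Finset.mem_univ i)
  have h2 : n i ≤ ∑ i, n i := Finset.single_le_sum (fun i _ => Nat.zero_le _) (Finset.mem_univ i)
  have h3 := wY_one_le z
  exact mul_le_mul h1 (pow_le_pow_right₀ h3 h2) (pow_nonneg (zero_le_one.trans h3) _)
    ((hC i).trans h1)

theorem index_choice (uu ww : Fin m → ℝ) (g : Fin m → Fin m → ℝ) (M α : ℝ) (hα : 0 < α)
    (hM : ∀ i, uu i - ww i ≤ M) (i1 : Fin m) (hi1 : uu i1 - ww i1 = M)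
    (hob : ∀ i j, j ≠ i → ww j - g i j ≤ ww i) (hg : ∀ i j, 0 ≤ g i j)
    (htri : ∀ i j l, j ≠ i → l ≠ i → l ≠ j → g i l < g i j + g j l)
    (hal : ∀ i j, i ≠ j → α < g i j + g j i) :
    ∃ i, uu i - ww i = M ∧ ∀ j, j ≠ i → uu j - g i j < uu i := by
  by_contra hcon
  push Not at hcon
  classical
  obtain ⟨i, hiS, himax⟩ := Finset.exists_max_image
    (Finset.univ.filter fun i => uu i - ww i = M) uu ⟨i1, by simp [hi1]⟩
  simp only [Finset.mem_filter, Finset.mem_univ, true_and] at hiS himax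
  have step : ∀ i, uu i - ww i = M → ∃ j, j ≠ i ∧ uu i + g i j ≤ uu j ∧ uu j - ww j = M := by
    intro i hi
    obtain ⟨j, hj, hle⟩ := hcon i hi
    have := hob i j hj
    have := hM j
    exact ⟨j, hj, by linarith, by linarith⟩
  obtain ⟨j, hji, h1, hj⟩ := step i hiS
  have h2 := himax j hj
  obtain ⟨l, hlj, h3, hl⟩ := step j hj
  have h4 := himax l hl
  have h5 := hg i j
  have h6 := hg j l
  by_cases hli : l = i
  · subst hli
    have := hal l j (Ne.symm hji)
    linarith
  · have h7 := htri i j l hji hli hlj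
    have := hg i l
    linarith
end
end SwitchingPDE
end
end

section
open Set Filter Topology

noncomputable section
namespace SwitchingPDE
section
variable {k d m : ℕ}

/-- an interior positive maximum of the penalised difference is impossible -/
theorem no_interior_max {T α : ℝ} (hm : 2 ≤ m) (hα : 0 < α)
    {σ : ℝ → EuclideanSpace ℝ (Fin k) → Fin k → Fin d → ℝ}
    {b : ℝ → EuclideanSpace ℝ (Fin k) → EuclideanSpace ℝ (Fin k)}
    {ψ : Fin m → ℝ → EuclideanSpace ℝ (Fin k) → ℝ}
    {g : Fin m → Fin m → ℝ → EuclideanSpace ℝ (Fin k) → ℝ}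
    (H : PDEHyps T α σ b ψ g)
    {u w : Fin m → ℝ → EuclideanSpace ℝ (Fin k) → ℝ}
    (cu : ∀ i, ContinuousOn (fun p : ℝ × EuclideanSpace ℝ (Fin k) => u i p.1 p.2)
      (Icc 0 T ×ˢ univ))
    (cw : ∀ i, ContinuousOn (fun p : ℝ × EuclideanSpace ℝ (Fin k) => w i p.1 p.2)
      (Icc 0 T ×ˢ univ))
    (hu : IsViscositySubsolution T σ b ψ g u) (hw : IsViscositySupersolution T σ b ψ g w)
    (P : ℝ × EuclideanSpace ℝ (Fin k) → ℝ) (hP : ContDiff ℝ 2 P)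
    (zb : ℝ × EuclideanSpace ℝ (Fin k)) (hzb : zb.1 ∈ Ioo 0 T) (M : ℝ) (i1 : Fin m)
    (hi1 : u i1 zb.1 zb.2 - w i1 zb.1 zb.2 - P zb = M)
    (hM : ∀ i, ∀ z : ℝ × EuclideanSpace ℝ (Fin k), z.1 ∈ Icc 0 T →
      u i z.1 z.2 - w i z.1 z.2 - P z ≤ M) : 0 ≤ Lop σ b P zb := by
  have hz' : zb.1 ∈ Icc 0 T := Ioo_subset_Icc_self hzb
  have hOm : Ioo 0 T ×ˢ univ ∈ 𝓝 zb :=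
    (isOpen_Ioo.prod isOpen_univ).mem_nhds ⟨hzb, mem_univ _⟩
  have hsubset : (Ioo 0 T ×ˢ univ : Set (ℝ × EuclideanSpace ℝ (Fin k))) ⊆ Icc 0 T ×ˢ univ :=
    prod_mono Ioo_subset_Icc_self Subset.rfl
  have hIcc := mem_of_superset hOm hsubset
  obtain ⟨i, hi, hlt⟩ := index_choice (fun i => u i zb.1 zb.2) (fun i => w i zb.1 zb.2)
    (fun i j => g i j zb.1 zb.2) (M + P zb) α hα (fun i => by have := hM i zb hz'; linarith)
    i1 (by linarith) (fun i j hj => obstacle hw cw H.g_cont i j hj zb hzb)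
    (fun i j => H.g_nonneg i j zb.1 hz' zb.2)
    (fun i j l h1 h2 h3 => H.g_triangle i j l h1 h2 h3 zb.1 hz' zb.2)
    (fun i j h => H.g_alpha i j h zb.1 hz' zb.2)
  have hev : ∀ᶠ z in 𝓝 zb, ∀ j, j ≠ i → u j z.1 z.2 - g i j z.1 z.2 < u i z.1 z.2 := by
    refine eventually_all.mpr fun j => ?_
    by_cases hj : j = i
    · exact Eventually.of_forall fun z h => absurd hj h
    · have c1 := ((cu j).sub (H.g_cont i j)).continuousAt hIcc
      have c2 := (cu i).continuousAt hIcc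
      exact (c1.eventually_lt c2 (hlt j hj)).mono fun z h _ => h
  refine local_comparison σ b (col_continuousOn H.σ_cont) H.b_cont (lip_split H.lipschitz)
    (fun z => ψ i z.1 z.2) (fun z => u i z.1 z.2) (fun z => w i z.1 z.2) P (H.ψ_cont i)
    (cu i) (cw i) hP zb hzb ?_ ?_ ?_
  · filter_upwards [hIcc] with z hz
    have := hM i z hz.1
    linarith
  · filter_upwards [hev, hOm] with z hz hz2 φ hφ he hle
    exact sub_pde hm hu i z hz2.1 φ hφ he hle hz
  · filter_upwards [hOm] with z hz2 φ hφ he hle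
    exact (super_pde hw i z hz2.1 φ hφ he hle).2

theorem comparison_interior {T α : ℝ} (hT : 0 < T) (hm : 2 ≤ m) (hα : 0 < α)
    {σ : ℝ → EuclideanSpace ℝ (Fin k) → Fin k → Fin d → ℝ}
    {b : ℝ → EuclideanSpace ℝ (Fin k) → EuclideanSpace ℝ (Fin k)}
    {ψ : Fin m → ℝ → EuclideanSpace ℝ (Fin k) → ℝ}
    {g : Fin m → Fin m → ℝ → EuclideanSpace ℝ (Fin k) → ℝ}
    (H : PDEHyps T α σ b ψ g)
    {u w : Fin m → ℝ → EuclideanSpace ℝ (Fin k) → ℝ}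
    (huC : ∀ i, InClassC T (u i)) (hwC : ∀ i, InClassC T (w i))
    (huT : ∀ i x, u i T x = 0) (hwT : ∀ i x, w i T x = 0)
    (hu : IsViscositySubsolution T σ b ψ g u) (hw : IsViscositySupersolution T σ b ψ g w)
    (i0 : Fin m) (zs : ℝ × EuclideanSpace ℝ (Fin k)) (hzs : zs.1 ∈ Ioo 0 T) :
    u i0 zs.1 zs.2 ≤ w i0 zs.1 zs.2 := by
  by_contra hcon
  obtain ⟨g0, hg0⟩ : ∃ g0, g0 = u i0 zs.1 zs.2 - w i0 zs.1 zs.2 := ⟨_, rfl⟩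
  have hg0p : 0 < g0 := by linarith [not_le.mp hcon]
  obtain ⟨Cu, nu, hCu, gu⟩ := growth_family hT u huC
  obtain ⟨Cw, nw, hCw, gw⟩ := growth_family hT w hwC
  obtain ⟨n, hn⟩ : ∃ n, n = nu + nw := ⟨_, rfl⟩
  obtain ⟨Cg, hCg⟩ : ∃ Cg, Cg = Cu + Cw + 1 := ⟨_, rfl⟩
  have hCgp : 0 < Cg := by linarith
  have hgr : ∀ i, ∀ z : ℝ × EuclideanSpace ℝ (Fin k), z.1 ∈ Icc 0 T →
      u i z.1 z.2 - w i z.1 z.2 ≤ Cg * wY z ^ n := by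
    intro i z hz
    have h1 := (le_abs_self _).trans (gu i z hz)
    have h2 := (neg_abs_le (w i z.1 z.2))
    have h3 := gw i z hz
    have hY := wY_one_le z
    have h4 : wY z ^ nu ≤ wY z ^ n := pow_le_pow_right₀ hY (by omega)
    have h5 : wY z ^ nw ≤ wY z ^ n := pow_le_pow_right₀ hY (by omega)
    have h6 := mul_le_mul_of_nonneg_left h4 hCu
    have h7 := mul_le_mul_of_nonneg_left h5 hCw
    have h8 : 0 ≤ wY z ^ n := pow_nonneg (zero_le_one.trans hY) _
    rw [hCg]
    linarith
  obtain ⟨C1, hC1⟩ := Ctrl_wY hT (col_continuousOn H.σ_cont) H.b_cont (lip_split H.lipschitz)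
  obtain ⟨D, hD⟩ := Ctrl_pow hC1 n
  have hD0 : 0 ≤ D := hD.2.1
  obtain ⟨Φ, hΦ⟩ : ∃ Φ : ℝ × EuclideanSpace ℝ (Fin k) → ℝ,
    Φ = fun y => tE D y * wY y ^ (n + 1) := ⟨_, rfl⟩
  have cΦ : ContDiff ℝ 2 Φ := by rw [hΦ]; exact (tE_contDiff D).mul hD.1
  have LΦ : ∀ z, z.1 ∈ Icc 0 T → Lop σ b Φ z ≤ 0 := fun z hz => by
    rw [hΦ]; exact Lop_weight hD z hz
  obtain ⟨ε, hε⟩ : ∃ ε, ε = Real.exp (-D * T) := ⟨_, rfl⟩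
  have hεp : 0 < ε := by rw [hε]; exact Real.exp_pos _
  have hYp : ∀ z : ℝ × EuclideanSpace ℝ (Fin k), 0 < wY z := fun z =>
    zero_lt_one.trans_le (wY_one_le z)
  have Φpos : ∀ z, 0 < Φ z := fun z => by
    rw [hΦ]; exact mul_pos (Real.exp_pos _) (pow_pos (hYp z) _)
  have Φge : ∀ z, z.1 ∈ Icc 0 T → ε * wY z ^ (n + 1) ≤ Φ z := fun z hz => by
    rw [hΦ, hε]
    refine mul_le_mul_of_nonneg_right ?_ (pow_nonneg (hYp z).le _)
    exact Real.exp_le_exp.mpr (by nlinarith [hz.2])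
  obtain ⟨θ, hθ⟩ : ∃ θ, θ = g0 / (3 * Φ zs) := ⟨_, rfl⟩
  have hθp : 0 < θ := by rw [hθ]; exact div_pos hg0p (mul_pos (by norm_num) (Φpos zs))
  have hθe : θ * Φ zs = g0 / 3 := by
    rw [hθ]; have := (Φpos zs).ne'; field_simp
  obtain ⟨R, hR⟩ : ∃ R, R = Cg / (θ * ε) := ⟨_, rfl⟩
  have hRp : 0 < R := by rw [hR]; positivity
  have hRe : θ * ε * R = Cg := by rw [hR]; field_simp
  obtain ⟨A, hA⟩ : ∃ A, A = Cg * R ^ n + 1 := ⟨_, rfl⟩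
  have hAp : 0 < A := by rw [hA]; positivity
  have hts := hzs.1
  obtain ⟨B, hB⟩ : ∃ B, B = 3 * A / (g0 * zs.1) := ⟨_, rfl⟩
  have hBp : 0 < B := by rw [hB]; positivity
  have hBe : g0 * (B * zs.1) = 3 * A := by rw [hB]; field_simp
  have tEp : ∀ z : ℝ × EuclideanSpace ℝ (Fin k), 0 < tE B z := fun z => Real.exp_pos _
  have hAe : A * tE B zs ≤ g0 / 3 := by
    have h1 := Real.add_one_le_exp (B * zs.1)
    have h2 : tE B zs * Real.exp (B * zs.1) = 1 := by
      unfold tE; rw [← Real.exp_add]; simp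
    have h3 : tE B zs * (B * zs.1) ≤ 1 := by
      have := mul_le_mul_of_nonneg_left h1 (tEp zs).le
      linarith [tEp zs]
    have h4 := mul_le_mul_of_nonneg_left h3 hg0p.le
    have h5 : g0 * (tE B zs * (B * zs.1)) = tE B zs * (3 * A) := by rw [← hBe]; ring
    linarith
  obtain ⟨P, hPd⟩ : ∃ P : ℝ × EuclideanSpace ℝ (Fin k) → ℝ,
    P = fun z => θ * Φ z + A * tE B z := ⟨_, rfl⟩
  have hPz : ∀ z, P z = θ * Φ z + A * tE B z := fun z => by rw [hPd]
  have cP : ContDiff ℝ 2 P := by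
    rw [hPd]; exact (contDiff_const.mul cΦ).add (contDiff_const.mul (tE_contDiff B))
  have LP : ∀ z, z.1 ∈ Icc 0 T → Lop σ b P z < 0 := fun z hz => by
    rw [hPd, Lop_add σ b _ _ (contDiff_const.mul cΦ) (contDiff_const.mul (tE_contDiff B)),
      Lop_const_mul σ b _ cΦ, Lop_const_mul σ b _ (tE_contDiff B), Lop_tE]
    have h1 := mul_nonpos_of_nonneg_of_nonpos hθp.le (LΦ z hz)
    have h2 : 0 < A * (B * tE B z) := mul_pos hAp (mul_pos hBp (tEp z))
    linarith
  have Ppos : ∀ z, 0 < P z := fun z => by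
    rw [hPz]; exact add_pos (mul_pos hθp (Φpos z)) (mul_pos hAp (tEp z))
  have far : ∀ i z, z.1 ∈ Icc 0 T → R ≤ wY z → u i z.1 z.2 - w i z.1 z.2 - P z < 0 := by
    intro i z hz hRz
    have h1 := hgr i z hz
    have h2 := mul_le_mul_of_nonneg_left (Φge z hz) hθp.le
    have h3 : Cg * wY z ^ n ≤ θ * (ε * wY z ^ (n + 1)) := by
      have h4 := mul_le_mul_of_nonneg_left hRz
        (mul_nonneg (mul_pos hθp hεp).le (pow_nonneg (hYp z).le n))
      calc Cg * wY z ^ n = θ * ε * wY z ^ n * R := by rw [← hRe]; ring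
        _ ≤ θ * ε * wY z ^ n * wY z := h4
        _ = θ * (ε * wY z ^ (n + 1)) := by ring
    rw [hPz]
    have := mul_pos hAp (tEp z)
    linarith
  have atT : ∀ i z, z.1 = T → u i z.1 z.2 - w i z.1 z.2 - P z < 0 := by
    intro i z hz
    have := Ppos z
    rw [hz, huT, hwT]
    linarith
  have at0 : ∀ i z, z.1 = 0 → u i z.1 z.2 - w i z.1 z.2 - P z < 0 := by
    intro i z hz
    have hz' : z.1 ∈ Icc 0 T := by rw [hz]; exact ⟨le_rfl, hT.le⟩
    rcases le_total R (wY z) with h | h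
    · exact far i z hz' h
    · have h1 := hgr i z hz'
      have h2 := mul_le_mul_of_nonneg_left (pow_le_pow_left₀ (hYp z).le h n) hCgp.le
      have h3 : tE B z = 1 := by unfold tE; rw [hz]; simp
      have h4 := mul_pos hθp (Φpos z)
      rw [hPz, h3]
      linarith
  -- maximisation
  have cu : ∀ i, ContinuousOn (fun p : ℝ × EuclideanSpace ℝ (Fin k) => u i p.1 p.2)
      (Icc 0 T ×ˢ univ) := fun i => (huC i).1
  have cw : ∀ i, ContinuousOn (fun p : ℝ × EuclideanSpace ℝ (Fin k) => w i p.1 p.2)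
      (Icc 0 T ×ˢ univ) := fun i => (hwC i).1
  have hKc : IsCompact (Icc 0 T ×ˢ Metric.closedBall (0 : EuclideanSpace ℝ (Fin k)) R) :=
    isCompact_Icc.prod (isCompact_closedBall _ _)
  have hKs : Icc 0 T ×ˢ Metric.closedBall (0 : EuclideanSpace ℝ (Fin k)) R ⊆ Icc 0 T ×ˢ univ :=
    prod_mono Subset.rfl (subset_univ _)
  have hmx := fun i => hKc.exists_isMaxOn
    ⟨(0, 0), ⟨⟨le_rfl, hT.le⟩, Metric.mem_closedBall_self hRp.le⟩⟩
    (f := fun z => u i z.1 z.2 - w i z.1 z.2 - P z)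
    ((((cu i).sub (cw i)).sub cP.continuous.continuousOn).mono hKs)
  choose zz hzK hzm using hmx
  have : Nonempty (Fin m) := ⟨i0⟩
  obtain ⟨i1, hi1⟩ := Finite.exists_max
    (fun i => u i (zz i).1 (zz i).2 - w i (zz i).1 (zz i).2 - P (zz i))
  have inK : ∀ i z, z.1 ∈ Icc 0 T → 0 ≤ u i z.1 z.2 - w i z.1 z.2 - P z →
      u i z.1 z.2 - w i z.1 z.2 - P z ≤
        u i1 (zz i1).1 (zz i1).2 - w i1 (zz i1).1 (zz i1).2 - P (zz i1) := by
    intro i z hz h0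
    have hzin : z ∈ Icc 0 T ×ˢ Metric.closedBall (0 : EuclideanSpace ℝ (Fin k)) R := by
      refine ⟨hz, ?_⟩
      by_contra hb
      have hb : R < ‖z.2‖ := by simpa using hb
      have : R ≤ wY z := by unfold wY; nlinarith [sq_nonneg (‖z.2‖ - 1)]
      linarith [far i z hz this]
    have h2 : u i z.1 z.2 - w i z.1 z.2 - P z ≤
        u i (zz i).1 (zz i).2 - w i (zz i).1 (zz i).2 - P (zz i) := hzm i hzin
    exact h2.trans (hi1 i)
  have hval : 0 < u i0 zs.1 zs.2 - w i0 zs.1 zs.2 - P zs := by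
    rw [← hg0, hPz]; linarith
  have hMp := hval.trans_le (inK i0 zs (Ioo_subset_Icc_self hzs) hval.le)
  have hz1 := (hzK i1).1
  have hzint : (zz i1).1 ∈ Ioo 0 T := by
    refine ⟨lt_of_le_of_ne hz1.1 fun h => ?_, lt_of_le_of_ne hz1.2 fun h => ?_⟩
    · linarith [at0 i1 (zz i1) h.symm]
    · linarith [atT i1 (zz i1) h]
  have hfin := no_interior_max hm hα H cu cw hu hw P cP (zz i1) hzint _ i1 rfl (fun i z hz => by
    rcases le_total 0 (u i z.1 z.2 - w i z.1 z.2 - P z) with h | h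
    · exact inK i z hz h
    · exact h.trans hMp.le)
  linarith [LP (zz i1) hz1]

theorem comparison {T α : ℝ} (hT : 0 < T) (hm : 2 ≤ m) (hα : 0 < α)
    {σ : ℝ → EuclideanSpace ℝ (Fin k) → Fin k → Fin d → ℝ}
    {b : ℝ → EuclideanSpace ℝ (Fin k) → EuclideanSpace ℝ (Fin k)}
    {ψ : Fin m → ℝ → EuclideanSpace ℝ (Fin k) → ℝ}
    {g : Fin m → Fin m → ℝ → EuclideanSpace ℝ (Fin k) → ℝ}
    (H : PDEHyps T α σ b ψ g)
    {u w : Fin m → ℝ → EuclideanSpace ℝ (Fin k) → ℝ}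
    (huC : ∀ i, InClassC T (u i)) (hwC : ∀ i, InClassC T (w i))
    (huT : ∀ i x, u i T x = 0) (hwT : ∀ i x, w i T x = 0)
    (hu : IsViscositySubsolution T σ b ψ g u) (hw : IsViscositySupersolution T σ b ψ g w)
    (i : Fin m) (t : ℝ) (ht : t ∈ Icc 0 T) (x : EuclideanSpace ℝ (Fin k)) :
    u i t x ≤ w i t x := by
  have hcl : closure (Ioo 0 T) = Icc 0 T := closure_Ioo hT.ne
  have c : ∀ v : ℝ → EuclideanSpace ℝ (Fin k) → ℝ, InClassC T v →
      ContinuousOn (fun t => v t x) (closure (Ioo 0 T)) := by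
    intro v hv
    rw [hcl]
    exact hv.1.comp (f := fun t : ℝ => (t, x)) (by fun_prop) (fun t ht => ⟨ht, mem_univ _⟩)
  exact le_on_closure (s := Ioo 0 T) (f := fun t => u i t x) (g := fun t => w i t x)
    (fun t ht => comparison_interior hT hm hα H huC hwC huT hwT hu hw i (t, x) ht)
    (c _ (huC i)) (c _ (hwC i)) (by rw [hcl]; exact ht)
end
end SwitchingPDE
end
end

noncomputable section

namespace SwitchingPDE

/-- **Uniqueness of the viscosity solution**: the system of variational inequalities with
inter-connected obstacles `min{v_i − max_{j≠i}(−g_{ij}+v_j), −∂_t v_i − A v_i − ψ_i} = 0`,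
`v_i(T,·) ≡ 0`, has at most one viscosity solution in the class `C`: if `(v_1,…,v_m)` and
`(v̄_1,…,v̄_m)` are both viscosity solutions of polynomial growth, then `v_i = v̄_i` on
`[0,T] × ℝ^k` for every `i`. -/
theorem viscosity_solution_uniqueness {k d m : ℕ} {T α : ℝ}
    (hT : 0 < T) (hk : 1 ≤ k) (hd : 1 ≤ d) (hm : 2 ≤ m) (hα : 0 < α)
    (σ : ℝ → EuclideanSpace ℝ (Fin k) → Fin k → Fin d → ℝ)
    (b : ℝ → EuclideanSpace ℝ (Fin k) → EuclideanSpace ℝ (Fin k))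
    (ψ : Fin m → ℝ → EuclideanSpace ℝ (Fin k) → ℝ)
    (g : Fin m → Fin m → ℝ → EuclideanSpace ℝ (Fin k) → ℝ)
    (H : PDEHyps T α σ b ψ g)
    (v vbar : Fin m → ℝ → EuclideanSpace ℝ (Fin k) → ℝ)
    (hvC : ∀ i, InClassC T (v i)) (hvbarC : ∀ i, InClassC T (vbar i))
    (hvT : ∀ i x, v i T x = 0) (hvbarT : ∀ i x, vbar i T x = 0)
    (hvsub : IsViscositySubsolution T σ b ψ g v)
    (hvsup : IsViscositySupersolution T σ b ψ g v)
    (hvbarsub : IsViscositySubsolution T σ b ψ g vbar)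
    (hvbarsup : IsViscositySupersolution T σ b ψ g vbar) :
    ∀ i : Fin m, ∀ t ∈ Icc (0 : ℝ) T, ∀ x : EuclideanSpace ℝ (Fin k),
      v i t x = vbar i t x := by
  intro i t ht x
  exact le_antisymm
    (comparison hT hm hα H hvC hvbarC hvT hvbarT hvsub hvbarsup i t ht x)
    (comparison hT hm hα H hvbarC hvC hvbarT hvT hvbarsub hvsup i t ht x)

end SwitchingPDE

end
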